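/- arXiv:0906.5559 — 4 statements merged into one kernel-verified Lean document; each statement's English description precedes it below -/
import Mathlib

section
/- If a real binary form p of degree d, not identically zero, has τ real linear factors (counted with multiplicity) and admits a representation p(x,y) = Σ_{k=1}^r λ_k (cos θ_k · x - sin θ_k · y)^d with -π/2 < θ_1 < ... < θ_r ≤ π/2, r ≥ 2, all λ_k ≠ 0, then τ ≤ σ, where σ is the number of sign changes in the sequence (λ_1, λ_2, ..., λ_r, (-1)^d λ_1). -/
namespace BinaryForm

open Polynomial

/-- The dehomogenization `a X + b` of the binary linear form `a x + b y`. -/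
noncomputable def linear (v : ℝ × ℝ) : ℝ[X] := C v.1 * X + C v.2

/-- The binary form of degree `d` with dehomogenization `P` has at least `m` real linear factors,
counted with multiplicity. -/
def HasLinearFactors (P : ℝ[X]) (d m : ℕ) : Prop :=
  ∃ (s : Multiset (ℝ × ℝ)) (q : ℝ[X]), (∀ v ∈ s, v ≠ 0) ∧ P = (s.map linear).prod * q ∧
    m ≤ Multiset.card s ∧ Multiset.card s + q.natDegree ≤ d

/-- The dehomogenization of `∑ i, μ i (a i x + b i y) ^ d`. -/
noncomputable def powerSum {ι : Type*} [Fintype ι] (μ a b : ι → ℝ) (d : ℕ) : ℝ[X] :=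
  ∑ i, C (μ i) * (C (a i) * X + C (b i)) ^ d

theorem natDegree_linear_le (v : ℝ × ℝ) : (linear v).natDegree ≤ 1 :=
  Polynomial.natDegree_linear_le

theorem natDegree_prod_linear_le (s : Multiset (ℝ × ℝ)) :
    (s.map linear).prod.natDegree ≤ Multiset.card s := by
  induction s using Multiset.induction with
  | empty => simp
  | cons v s ih =>
    rw [Multiset.map_cons, Multiset.prod_cons, Multiset.card_cons, add_comm]
    exact natDegree_mul_le_of_le (natDegree_linear_le v) ih

theorem reflect_linear (a b : ℝ) : reflect 1 (C a * X + C b) = C b * X + C a := by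
  rw [reflect_add, reflect_C_mul, reflect_one_X, reflect_C, pow_one, mul_one, add_comm]

theorem reflect_prod_linear (s : Multiset (ℝ × ℝ)) :
    reflect (Multiset.card s) (s.map linear).prod = ((s.map Prod.swap).map linear).prod := by
  induction s using Multiset.induction with
  | empty => simp
  | cons v s ih =>
    simp only [Multiset.map_cons, Multiset.prod_cons, Multiset.card_cons]
    rw [add_comm, reflect_mul _ _ (natDegree_linear_le v) (natDegree_prod_linear_le s), ih,
      linear, reflect_linear]
    rfl

theorem comp_prod_linear (s : Multiset (ℝ × ℝ)) (t : ℝ) :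
    (s.map linear).prod.comp (X + C t) =
      ((s.map fun v => (v.1, v.2 + t * v.1)).map linear).prod := by
  rw [multiset_prod_comp, Multiset.map_map, Multiset.map_map]
  congr 2
  funext v
  simp [linear]
  ring

namespace HasLinearFactors

variable {P : ℝ[X]} {d m : ℕ}

theorem of_C_mul {c : ℝ} (hc : c ≠ 0) (h : HasLinearFactors (C c * P) d m) :
    HasLinearFactors P d m := by
  obtain ⟨s, q, hs, hP, hm, hd⟩ := h
  refine ⟨s, C c⁻¹ * q, hs, ?_, hm, ?_⟩
  · rw [mul_left_comm, ← hP, ← mul_assoc, ← C_mul, inv_mul_cancel₀ hc, C_1, one_mul]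
  · rwa [natDegree_C_mul (inv_ne_zero hc)]

theorem reflect (h : HasLinearFactors P d m) : HasLinearFactors (P.reflect d) d m := by
  obtain ⟨s, q, hs, rfl, hm, hd⟩ := h
  obtain ⟨e, rfl⟩ := Nat.exists_eq_add_of_le ((Nat.le_add_right _ _).trans hd)
  have hq : q.natDegree ≤ e := by omega
  refine ⟨s.map Prod.swap, q.reflect e, ?_, ?_, by simpa, ?_⟩
  · intro v hv h0
    obtain ⟨w, hw, rfl⟩ := Multiset.mem_map.1 hv
    exact hs w hw (by simpa [Prod.ext_iff, and_comm] using h0)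
  · rw [reflect_mul _ _ (natDegree_prod_linear_le s) hq, reflect_prod_linear]
  · rw [Multiset.card_map]
    have := natDegree_reflect_le (N := e) (p := q)
    omega

theorem comp_X_add_C (h : HasLinearFactors P d m) (t : ℝ) :
    HasLinearFactors (P.comp (X + C t)) d m := by
  obtain ⟨s, q, hs, rfl, hm, hd⟩ := h
  refine ⟨s.map fun v => (v.1, v.2 + t * v.1), q.comp (X + C t), ?_, ?_, by simpa, ?_⟩
  · intro v hv h0
    obtain ⟨w, hw, rfl⟩ := Multiset.mem_map.1 hv
    simp only [Prod.mk_eq_zero] at h0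
    exact hs w hw (Prod.ext h0.1 (by simpa [h0.1] using h0.2))
  · rw [mul_comp, comp_prod_linear]
  · simpa [natDegree_comp] using hd

theorem natDegree_add_le (h : HasLinearFactors P d m) (hP : P ≠ 0) :
    P.natDegree + m ≤ d + Multiset.card P.roots := by
  obtain ⟨s, q, hs, rfl, hm, hd⟩ := h
  suffices H : ((s.map linear).prod * q).natDegree + Multiset.card s ≤
      Multiset.card s + q.natDegree + Multiset.card ((s.map linear).prod * q).roots by omega
  clear hm hd
  induction s using Multiset.induction with
  | empty => simp
  | cons v s ih =>
    rw [Multiset.map_cons, Multiset.prod_cons, mul_assoc] at hP ⊢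
    have hQ := right_ne_zero_of_mul hP
    have hv := left_ne_zero_of_mul hP
    have ih := ih (fun w hw => hs w (Multiset.mem_cons_of_mem hw)) hQ
    rw [natDegree_mul hv hQ, roots_mul hP, Multiset.card_add, Multiset.card_cons]
    by_cases h1 : v.1 = 0
    · have : (linear v).natDegree = 0 := by simp [linear, h1]
      omega
    · have : (linear v).natDegree = 1 := natDegree_linear h1
      have : Multiset.card (linear v).roots = 1 := by
        simp [linear, roots_C_mul_X_add_C _ h1]
      omega

theorem of_natDegree_add_le (hd : P.natDegree ≤ d)
    (h : P.natDegree + m ≤ d + Multiset.card P.roots) : HasLinearFactors P d m := by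
  obtain ⟨q, hq, hc, -⟩ := exists_prod_multiset_X_sub_C_mul P
  refine ⟨P.roots.map (fun t => (1, -t)) + Multiset.replicate (d - P.natDegree) (0, 1), q,
    ?_, ?_, ?_, ?_⟩
  · intro v hv
    rcases Multiset.mem_add.1 hv with hv | hv
    · obtain ⟨t, -, rfl⟩ := Multiset.mem_map.1 hv
      simp
    · rw [Multiset.eq_of_mem_replicate hv]
      simp
  · conv_lhs => rw [← hq]
    simp [linear, sub_eq_add_neg, Function.comp_def]
  · simp
    omega
  · simp
    omega

/-- Rolle's theorem for binary forms. -/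
theorem derivative (h : HasLinearFactors P (d + 1) (m + 1)) (hP : P.derivative ≠ 0) :
    HasLinearFactors P.derivative d m := by
  have hP0 : P ≠ 0 := by
    rintro rfl
    simp at hP
  have hn : P.natDegree ≠ 0 := fun h0 => hP (derivative_of_natDegree_zero h0)
  have hroots := card_roots_le_derivative P
  have hdeg := natDegree_derivative_le P
  have hle := h.natDegree_add_le hP0
  have hd : P.natDegree ≤ d + 1 := by
    obtain ⟨s, q, -, rfl, -, hd⟩ := h
    exact (natDegree_mul_le_of_le (natDegree_prod_linear_le s) le_rfl).trans hd
  exact of_natDegree_add_le (by omega) (by omega)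

end HasLinearFactors

section powerSum

variable {ι : Type*} [Fintype ι] (μ a b : ι → ℝ) (d : ℕ)

theorem reflect_powerSum : (powerSum μ a b d).reflect d = powerSum μ b a d := by
  have hpow : ∀ (u v : ℝ) (n : ℕ),
      ((C u * X + C v) ^ n).reflect n = (C v * X + C u) ^ n := by
    intro u v n
    simpa [linear] using reflect_prod_linear (Multiset.replicate n (u, v))
  ext n
  simp only [powerSum, coeff_reflect, finsetSum_coeff, coeff_C_mul, ← hpow (a _) (b _)]

theorem powerSum_comp (t : ℝ) :
    (powerSum μ a b d).comp (X + C t) = powerSum μ a (fun i => b i + t * a i) d := by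
  simp only [powerSum, sum_comp, mul_comp, C_comp, pow_comp, add_comp, X_comp]
  refine Finset.sum_congr rfl fun i _ => ?_
  congr 2
  simp
  ring

theorem derivative_powerSum : (powerSum μ a b (d + 1)).derivative =
    C ((d : ℝ) + 1) * powerSum (fun i => μ i * a i) a b d := by
  simp only [powerSum, derivative_sum, Finset.mul_sum]
  refine Finset.sum_congr rfl fun i _ => ?_
  simp [derivative_pow]
  ring

variable {μ a b d} {m : ℕ}

/-- Polar derivatives of a binary form with real linear factors lose at most one of them. -/
theorem HasLinearFactors.polar (u v : ℝ)
    (h : HasLinearFactors (powerSum μ a b (d + 1)) (d + 1) (m + 1))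
    (h0 : powerSum (fun i => μ i * (a i * u + b i * v)) a b d ≠ 0) :
    HasLinearFactors (powerSum (fun i => μ i * (a i * u + b i * v)) a b d) d m := by
  have hd : ((d : ℝ) + 1) ≠ 0 := by positivity
  have key : ∀ a b : ι → ℝ, HasLinearFactors (powerSum μ a b (d + 1)) (d + 1) (m + 1) →
      powerSum (fun i => μ i * a i) a b d ≠ 0 →
      HasLinearFactors (powerSum (fun i => μ i * a i) a b d) d m := by
    intro a b h h0
    refine HasLinearFactors.of_C_mul hd ?_
    rw [← derivative_powerSum]
    refine h.derivative ?_
    rw [derivative_powerSum]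
    exact mul_ne_zero (C_ne_zero.2 hd) h0
  have scale : ∀ (c : ℝ) (ν : ι → ℝ), powerSum (fun i => c * ν i) a b d =
      C c * powerSum ν a b d := by
    intro c ν
    simp only [powerSum, Finset.mul_sum, C_mul, mul_assoc]
  by_cases hv : v = 0
  · subst hv
    have e : (fun i => μ i * (a i * u + b i * 0)) = fun i => u * (μ i * a i) := by
      funext i
      ring
    rw [e, scale] at h0 ⊢
    have hu : u ≠ 0 := by
      rintro rfl
      simp at h0
    refine HasLinearFactors.of_C_mul (inv_ne_zero hu) ?_
    rw [← mul_assoc, ← C_mul, inv_mul_cancel₀ hu, C_1, one_mul]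
    exact key a b h (right_ne_zero_of_mul h0)
  · set t := u / v with ht
    have e : (fun i => μ i * (a i * u + b i * v)) = fun i => v * (μ i * (b i + t * a i)) := by
      funext i
      rw [ht]
      field_simp
      ring
    rw [e, scale] at h0 ⊢
    refine HasLinearFactors.of_C_mul (inv_ne_zero hv) ?_
    rw [← mul_assoc, ← C_mul, inv_mul_cancel₀ hv, C_1, one_mul]
    have back : ((powerSum (fun i => μ i * (b i + t * a i)) (fun i => b i + t * a i) a
        d).reflect d).comp (X + C (-t)) = powerSum (fun i => μ i * (b i + t * a i)) a b d := by
      rw [reflect_powerSum, powerSum_comp]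
      simp
    rw [← back]
    have h' := (h.comp_X_add_C t).reflect
    rw [powerSum_comp, reflect_powerSum] at h'
    refine ((key _ _ h' ?_).reflect).comp_X_add_C _
    intro hz
    rw [hz] at back
    rw [← back] at h0
    simp at h0

end powerSum


section SignChanges

/-- The number of sign changes of a finite sequence. -/
noncomputable def signChanges {r : ℕ} (μ : Fin (r + 1) → ℝ) : ℕ :=
  Nat.card {i : Fin r // μ i.castSucc * μ i.succ < 0}

/-- Multiplying by a sequence which changes sign exactly once, at a sign change of `μ`, removes
that sign change. -/
theorem signChanges_mul_add_one {r : ℕ} {μ g : Fin (r + 1) → ℝ} {j : Fin r}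
    (hj : μ j.castSucc * μ j.succ < 0) (hpos : ∀ i ≤ j.castSucc, 0 < g i)
    (hneg : ∀ i, j.castSucc < i → g i < 0) :
    signChanges (fun i => μ i * g i) + 1 = signChanges μ := by
  classical
  simp only [signChanges, Nat.card_eq_fintype_card, Fintype.card_subtype]
  have hmem : j ∈ Finset.univ.filter fun i : Fin r => μ i.castSucc * μ i.succ < 0 := by
    simpa using hj
  rw [← Finset.card_erase_add_one hmem]
  congr 2
  ext i
  have hmul : μ i.castSucc * g i.castSucc * (μ i.succ * g i.succ) =
      (μ i.castSucc * μ i.succ) * (g i.castSucc * g i.succ) := by ring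
  simp only [Finset.mem_filter, Finset.mem_univ, true_and, Finset.mem_erase, hmul]
  rcases lt_trichotomy i j with h | rfl | h
  · have h1 := hpos i.castSucc (Fin.castSucc_le_castSucc_iff.2 h.le)
    have h2 := hpos i.succ (Fin.succ_le_castSucc_iff.2 h)
    have h12 := mul_pos h1 h2
    simp [h.ne, mul_neg_iff, h12, h12.not_gt]
  · have h1 := hpos i.castSucc le_rfl
    have h2 := hneg i.succ (by simp)
    simpa using (mul_pos_of_neg_of_neg hj (mul_neg_of_pos_of_neg h1 h2)).le
  · have h1 := hneg i.castSucc (Fin.castSucc_lt_castSucc_iff.2 h)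
    have h2 := hneg i.succ ((Fin.castSucc_lt_castSucc_iff.2 h).trans (by simp))
    have h12 := mul_pos_of_neg_of_neg h1 h2
    simp [h.ne', mul_neg_iff, h12, h12.not_gt]

/-- A sequence without sign changes has constant sign. -/
theorem mul_pos_of_signChanges_eq_zero {r : ℕ} {μ : Fin (r + 1) → ℝ} (hμ : ∀ i, μ i ≠ 0)
    (h : signChanges μ = 0) (i : Fin (r + 1)) : 0 < μ 0 * μ i := by
  have hstep : ∀ i : Fin r, 0 < μ i.castSucc * μ i.succ := by
    intro i
    rw [signChanges, Finite.card_eq_zero_iff] at h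
    exact (not_lt.1 fun hi => h.elim ⟨i, hi⟩).lt_of_ne'
      (mul_ne_zero (hμ _) (hμ _))
  induction i using Fin.induction with
  | zero => exact mul_self_pos.2 (hμ 0)
  | succ i ih =>
    have := mul_pos ih (hstep i)
    have e : μ 0 * μ i.castSucc * (μ i.castSucc * μ i.succ) =
        (μ i.castSucc * μ i.castSucc) * (μ 0 * μ i.succ) := by ring
    rw [e] at this
    exact pos_of_mul_pos_right this (mul_self_nonneg _)

/-- The vectors `(a i, -b i)` wind anticlockwise through a half turn, from the vector of index `0`
to its opposite. -/
structure IsHalfTurn {r : ℕ} (a b : Fin (r + 1) → ℝ) : Prop where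
  fst_last : a (Fin.last r) = -a 0
  snd_last : b (Fin.last r) = -b 0
  det_pos : ∀ i j, i < j → ¬(i = 0 ∧ j = Fin.last r) → 0 < b i * a j - a i * b j

variable {r : ℕ} {a b : Fin (r + 1) → ℝ}

theorem IsHalfTurn.det_nonneg (h : IsHalfTurn a b) {i j : Fin (r + 1)} (hij : i ≤ j) :
    0 ≤ b i * a j - a i * b j := by
  rcases hij.eq_or_lt with rfl | hij
  · linarith [mul_comm (b i) (a i)]
  by_cases hc : i = 0 ∧ j = Fin.last r
  · obtain ⟨rfl, rfl⟩ := hc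
    rw [h.fst_last, h.snd_last]
    linarith [mul_comm (b 0) (a 0)]
  · exact (h.det_pos i j hij hc).le

theorem IsHalfTurn.combination_pos (h : IsHalfTurn a b) (hr : 2 ≤ r) {j : Fin r} {x y : ℝ}
    (hx : 0 < x) (hy : 0 < y) {i : Fin (r + 1)} (hi : i ≤ j.castSucc) :
    0 < x * (b i * a j.castSucc - a i * b j.castSucc) +
      y * (b i * a j.succ - a i * b j.succ) := by
  have hij : i < j.succ := hi.trans_lt (by simp)
  have h1 := h.det_nonneg hi
  have h2 := h.det_nonneg hij.le
  by_cases hc : i = 0 ∧ j.succ = Fin.last r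
  · have hj : i < j.castSucc := by
      obtain ⟨rfl, hc⟩ := hc
      simp only [Fin.ext_iff, Fin.val_succ, Fin.val_last] at hc
      simp only [Fin.lt_def, Fin.val_zero, Fin.val_castSucc]
      omega
    have := h.det_pos i j.castSucc hj (fun hl => (Fin.castSucc_lt_last j).ne hl.2)
    positivity
  · have := h.det_pos i j.succ hij hc
    positivity

theorem IsHalfTurn.combination_neg (h : IsHalfTurn a b) (hr : 2 ≤ r) {j : Fin r} {x y : ℝ}
    (hx : 0 < x) (hy : 0 < y) {i : Fin (r + 1)} (hi : j.castSucc < i) :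
    x * (b i * a j.castSucc - a i * b j.castSucc) +
      y * (b i * a j.succ - a i * b j.succ) < 0 := by
  by_cases hl : i = Fin.last r
  · subst hl
    have := h.combination_pos hr hx hy (Fin.zero_le j.castSucc)
    rw [h.fst_last, h.snd_last]
    linarith
  · have h1 := h.det_pos _ _ hi (fun hc => hl hc.2)
    have h2 := h.det_nonneg (Fin.castSucc_lt_iff_succ_le.1 hi)
    nlinarith [mul_pos hx h1, mul_nonneg hy.le h2]

theorem not_hasLinearFactors_of_even {ι : Type*} [Fintype ι] {μ a b : ι → ℝ} {d m : ℕ}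
    (hd : Even d) (hd0 : d ≠ 0) (hμ : ∀ i k, 0 < μ i * μ k) {i j : ι}
    (hij : b i * a j - a i * b j ≠ 0) (hm : m ≠ 0) :
    ¬ HasLinearFactors (powerSum μ a b d) d m := by
  have anisotropic : ∀ u v : ℝ, ∑ k, μ k * (a k * u + b k * v) ^ d = 0 → u = 0 ∧ v = 0 := by
    intro u v h
    have h' : ∑ k, μ i * μ k * (a k * u + b k * v) ^ d = 0 := by
      simp only [mul_assoc, ← Finset.mul_sum, h, mul_zero]
    rw [Finset.sum_eq_zero_iff_of_nonneg
      (fun k _ => mul_nonneg (hμ i k).le (hd.pow_nonneg _))] at h'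
    have hz : ∀ k, a k * u + b k * v = 0 := fun k => by
      simpa [(hμ i k).ne', hd0] using h' k (Finset.mem_univ k)
    constructor
    · exact (mul_eq_zero.1 (by linear_combination b i * hz j - b j * hz i :
        (b i * a j - a i * b j) * u = 0)).resolve_left hij
    · exact (mul_eq_zero.1 (by linear_combination a j * hz i - a i * hz j :
        (b i * a j - a i * b j) * v = 0)).resolve_left hij
  rintro ⟨s, q, hs, hP, hms, hsd⟩
  obtain ⟨v, hv⟩ := Multiset.card_pos_iff_exists_mem.1 (by omega : 0 < Multiset.card s)
  obtain ⟨s, rfl⟩ := Multiset.exists_cons_of_mem hv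
  rw [Multiset.map_cons, Multiset.prod_cons, mul_assoc] at hP
  rw [Multiset.card_cons] at hsd
  by_cases h1 : v.1 = 0
  · have hdeg : (powerSum μ a b d).natDegree < d := by
      rw [hP, linear, h1, C_0, zero_mul, zero_add]
      refine (natDegree_C_mul_le _ _).trans_lt ?_
      have := natDegree_mul_le_of_le (natDegree_prod_linear_le s) (le_refl q.natDegree)
      omega
    have hc := coeff_eq_zero_of_natDegree_lt hdeg
    have hpow : ∀ u v : ℝ, ((C u * X + C v) ^ d).coeff d = u ^ d := by
      intro u v
      simpa using coeff_pow_of_natDegree_le (m := d)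
        (Polynomial.natDegree_linear_le (a := u) (b := v))
    simp only [powerSum, finsetSum_coeff, coeff_C_mul, hpow] at hc
    exact one_ne_zero (anisotropic 1 0 (by simpa using hc)).1
  · have he := congrArg (eval (-v.2 / v.1)) hP
    have h0 : eval (-v.2 / v.1) (linear v) = 0 := by
      simp only [linear, eval_add, eval_mul, eval_C, eval_X]
      field_simp
      ring
    rw [eval_mul, h0, zero_mul] at he
    simp only [powerSum, eval_finsetSum, eval_mul, eval_pow, eval_add, eval_C, eval_X] at he
    exact one_ne_zero (anisotropic _ 1 (by simpa using he)).2

/-- A nonzero form `∑ μ i * ℓ i ^ (d + 1)` has a nonzero polar derivative at one of any two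
independent vectors. -/
theorem powerSum_eq_zero_of_polar_eq_zero {ι : Type*} [Fintype ι] {μ a b : ι → ℝ} {d : ℕ}
    {u v u' v' : ℝ} (hdet : u * v' - v * u' ≠ 0)
    (h : powerSum (fun i => μ i * (a i * u + b i * v)) a b d = 0)
    (h' : powerSum (fun i => μ i * (a i * u' + b i * v')) a b d = 0) :
    powerSum μ a b (d + 1) = 0 := by
  have key : C (u * v' - v * u') * powerSum μ a b (d + 1) =
      (C v' * X - C u') * powerSum (fun i => μ i * (a i * u + b i * v)) a b d +
      (C u - C v * X) * powerSum (fun i => μ i * (a i * u' + b i * v')) a b d := by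
    simp only [powerSum, Finset.mul_sum, ← Finset.sum_add_distrib]
    refine Finset.sum_congr rfl fun i _ => ?_
    simp only [C_mul, C_add, C_sub]
    ring
  rw [h, h', mul_zero, mul_zero, add_zero] at key
  exact (mul_eq_zero.1 key).resolve_left (C_ne_zero.2 hdet)

/-- **Sylvester's theorem**, in dehomogenized form. -/
theorem IsHalfTurn.le_signChanges (h : IsHalfTurn a b) (hr : 2 ≤ r) {d m : ℕ}
    {μ : Fin (r + 1) → ℝ} (hμ : ∀ i, μ i ≠ 0) (hlast : μ (Fin.last r) = (-1) ^ d * μ 0)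
    (hP : powerSum (fun i : Fin r => μ i.castSucc) (fun i => a i.castSucc)
      (fun i => b i.castSucc) d ≠ 0)
    (hm : HasLinearFactors (powerSum (fun i : Fin r => μ i.castSucc) (fun i => a i.castSucc)
      (fun i => b i.castSucc) d) d m) : m ≤ signChanges μ := by
  induction d generalizing μ m with
  | zero =>
    obtain ⟨s, q, -, -, hms, hsd⟩ := hm
    omega
  | succ d ih =>
    rcases Nat.eq_zero_or_pos m with rfl | hm0
    · exact Nat.zero_le _
    obtain ⟨m, rfl⟩ := Nat.exists_eq_succ_of_ne_zero hm0.ne'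
    rcases Nat.eq_zero_or_pos (signChanges μ) with hσ | hσ
    · have hpos := mul_pos_of_signChanges_eq_zero hμ hσ
      have heven : Even (d + 1) := by
        by_contra hodd
        have := hpos (Fin.last r)
        rw [hlast, (Nat.not_even_iff_odd.1 hodd).neg_one_pow] at this
        nlinarith [mul_self_nonneg (μ 0)]
      have hpos' : ∀ i k : Fin r, 0 < μ i.castSucc * μ k.castSucc := by
        intro i k
        have := mul_pos (hpos i.castSucc) (hpos k.castSucc)
        have e : μ 0 * μ i.castSucc * (μ 0 * μ k.castSucc) =
          μ 0 * μ 0 * (μ i.castSucc * μ k.castSucc) := by ring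
        rw [e] at this
        exact pos_of_mul_pos_right this (mul_self_nonneg _)
      refine absurd hm (not_hasLinearFactors_of_even heven d.succ_ne_zero hpos'
        (i := ⟨0, by omega⟩) (j := ⟨1, by omega⟩) (h.det_pos _ _ ?_ ?_).ne' m.succ_ne_zero)
      · simp [Fin.lt_def]
      · exact fun hc => (Fin.castSucc_lt_last _).ne hc.2
    · obtain ⟨⟨j, hj⟩⟩ : Nonempty {i : Fin r // μ i.castSucc * μ i.succ < 0} :=
        (Nat.card_pos_iff.1 hσ).1
      let g : ℝ → Fin (r + 1) → ℝ := fun y i =>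
        a i * (-(b j.castSucc + y * b j.succ)) + b i * (a j.castSucc + y * a j.succ)
      have hg : ∀ y i, g y i = 1 * (b i * a j.castSucc - a i * b j.castSucc) +
          y * (b i * a j.succ - a i * b j.succ) := fun y i => by simp only [g]; ring
      have hdet : 0 < b j.castSucc * a j.succ - a j.castSucc * b j.succ := by
        simpa [mul_comm] using h.combination_pos hr one_pos one_pos (le_refl j.castSucc)
      obtain ⟨y, hy, hne⟩ : ∃ y : ℝ, 0 < y ∧ powerSum (fun i : Fin r => μ i.castSucc *
          g y i.castSucc) (fun i => a i.castSucc) (fun i => b i.castSucc) d ≠ 0 := by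
        by_contra! hz
        refine hP (powerSum_eq_zero_of_polar_eq_zero ?_ (hz 1 one_pos) (hz 2 two_pos))
        intro h0
        exact hdet.ne' (by linear_combination -h0)
      have hpos : ∀ i ≤ j.castSucc, 0 < g y i := fun i hi =>
        hg y i ▸ h.combination_pos hr one_pos hy hi
      have hneg : ∀ i, j.castSucc < i → g y i < 0 := fun i hi =>
        hg y i ▸ h.combination_neg hr one_pos hy hi
      rw [← signChanges_mul_add_one hj hpos hneg]
      refine Nat.succ_le_succ (ih (fun i => mul_ne_zero (hμ i) ?_) ?_ hne (hm.polar _ _ hne))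
      · rcases le_or_gt i j.castSucc with hi | hi
        · exact (hpos i hi).ne'
        · exact (hneg i hi).ne
      · simp only [g, hlast, h.fst_last, h.snd_last]
        ring

end SignChanges

section Dehomogenization

variable {p : MvPolynomial (Fin 2) ℝ} {d : ℕ}

theorem aeval_X_one_ne_zero (hp : p.IsHomogeneous d) (hp0 : p ≠ 0) :
    MvPolynomial.aeval ![(X : ℝ[X]), 1] p ≠ 0 := by
  intro h
  exact hp0 (by rw [← homogenize_eq_of_isHomogeneous hp h, homogenize_zero])

theorem hasLinearFactors_aeval (hp : p.IsHomogeneous d) (hp0 : p ≠ 0) {m : ℕ} {a b : Fin m → ℝ}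
    (hab : ∀ i, (a i, b i) ≠ (0, 0)) {q : MvPolynomial (Fin 2) ℝ}
    (hq : p = (∏ i, (a i • MvPolynomial.X 0 + b i • MvPolynomial.X 1)) * q) :
    HasLinearFactors (MvPolynomial.aeval ![X, 1] p) d m := by
  subst hq
  have hprod := left_ne_zero_of_mul hp0
  have hhom : (∏ i, (a i • MvPolynomial.X 0 + b i • MvPolynomial.X 1 :
      MvPolynomial (Fin 2) ℝ)).IsHomogeneous m := by
    have := MvPolynomial.IsHomogeneous.prod Finset.univ
      (fun i => (a i • MvPolynomial.X 0 + b i • MvPolynomial.X 1 : MvPolynomial (Fin 2) ℝ))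
      (fun _ => 1) fun i _ => by
        simp only [MvPolynomial.smul_eq_C_mul]
        exact (MvPolynomial.isHomogeneous_C_mul_X _ _).add
          (MvPolynomial.isHomogeneous_C_mul_X _ _)
    simpa using this
  have hdeg := MvPolynomial.totalDegree_mul_of_isDomain hprod (right_ne_zero_of_mul hp0)
  rw [hp.totalDegree hp0, hhom.totalDegree hprod] at hdeg
  refine ⟨Finset.univ.val.map fun i => (a i, b i), MvPolynomial.aeval ![X, 1] q, ?_, ?_, ?_, ?_⟩
  · simpa using hab
  · rw [map_mul, map_prod, Multiset.map_map, Finset.prod]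
    simp [linear, smul_eq_C_mul, Function.comp_def]
  · simp
  · have := MvPolynomial.aeval_natDegree_le q le_rfl ![(X : ℝ[X]), 1] (n := 1) (by
      intro i
      fin_cases i <;> simp)
    simp
    omega

end Dehomogenization

end BinaryForm

open MvPolynomial

theorem stmt4 (d r τ : ℕ) (hr : 2 ≤ r)
    (p : MvPolynomial (Fin 2) ℝ) (hp0 : p ≠ 0)
    (hhom : p ∈ MvPolynomial.homogeneousSubmodule (Fin 2) ℝ d)
    (θ : Fin r → ℝ) (hθmono : StrictMono θ)
    (hθlo : -(Real.pi/2) < θ ⟨0, by omega⟩) (hθhi : θ ⟨r-1, by omega⟩ ≤ Real.pi/2)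
    (lam : Fin r → ℝ) (hlam : ∀ k, lam k ≠ 0)
    (hrep : p = ∑ k : Fin r,
      lam k • (Real.cos (θ k) • X 0 - Real.sin (θ k) • X 1 : MvPolynomial (Fin 2) ℝ) ^ d)
    (ea eb : Fin τ → ℝ) (he : ∀ i, (ea i, eb i) ≠ (0, 0))
    (q : MvPolynomial (Fin 2) ℝ)
    (hfac : p = (∏ i : Fin τ, (ea i • X 0 + eb i • X 1 : MvPolynomial (Fin 2) ℝ)) * q)
    (μ : Fin (r+1) → ℝ)
    (hμ : ∀ i : Fin r, μ i.castSucc = lam i)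
    (hμr : μ (Fin.last r) = (-1)^d * lam ⟨0, by omega⟩) :
    τ ≤ Nat.card {i : Fin r // μ i.castSucc * μ i.succ < 0} := by
  have hhalf : BinaryForm.IsHalfTurn
      (fun i => Real.cos ((Fin.snoc θ (θ ⟨0, by omega⟩ + Real.pi) : Fin (r + 1) → ℝ) i))
      (fun i => -Real.sin ((Fin.snoc θ (θ ⟨0, by omega⟩ + Real.pi) : Fin (r + 1) → ℝ) i)) := by
    have h0 : (Fin.snoc θ (θ ⟨0, by omega⟩ + Real.pi) : Fin (r + 1) → ℝ) 0 =
        θ ⟨0, by omega⟩ := Fin.snoc_castSucc (α := fun _ => ℝ) _ θ ⟨0, by omega⟩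
    have hlo : ∀ i, θ ⟨0, by omega⟩ ≤ θ i := fun i => hθmono.monotone (Nat.zero_le i)
    have hhi : ∀ i, θ i ≤ θ ⟨r - 1, by omega⟩ :=
      fun i => hθmono.monotone (Nat.le_sub_one_of_lt i.2)
    refine ⟨?_, ?_, fun i j hij hc => ?_⟩
    · simp only [h0, Fin.snoc_last, Real.cos_add_pi]
    · simp only [h0, Fin.snoc_last, Real.sin_add_pi]
    · obtain ⟨i, rfl⟩ := Fin.exists_castSucc_eq.2 (hij.trans_le (Fin.le_last j)).ne
      have hsub : ∀ x y : ℝ, 0 < x - y → x - y < Real.pi →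
          0 < -Real.sin y * Real.cos x - Real.cos y * -Real.sin x := by
        intro x y h1 h2
        have := Real.sin_pos_of_pos_of_lt_pi h1 h2
        rw [Real.sin_sub] at this
        linarith
      induction j using Fin.lastCases with
      | last =>
        have hi : θ ⟨0, by omega⟩ < θ i := by
          refine hθmono (Nat.pos_of_ne_zero fun hi => hc ⟨Fin.ext hi, rfl⟩)
        rw [Fin.snoc_castSucc, Fin.snoc_last]
        apply hsub <;> linarith [hhi i]
      | cast j =>
        rw [Fin.snoc_castSucc, Fin.snoc_castSucc]
        have := hθmono (Fin.castSucc_lt_castSucc_iff.1 hij)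
        apply hsub <;> linarith [hhi j, hlo i]
  have hμ0 : μ 0 = lam ⟨0, by omega⟩ := hμ ⟨0, by omega⟩
  have hsum : BinaryForm.powerSum (fun i : Fin r => μ i.castSucc)
      (fun i => Real.cos ((Fin.snoc θ (θ ⟨0, by omega⟩ + Real.pi) : Fin (r + 1) → ℝ) i.castSucc))
      (fun i => -Real.sin ((Fin.snoc θ (θ ⟨0, by omega⟩ + Real.pi) : Fin (r + 1) → ℝ)
        i.castSucc)) d = aeval ![Polynomial.X, 1] p := by
    rw [hrep]
    simp only [BinaryForm.powerSum, hμ, Fin.snoc_castSucc]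
    simp [Polynomial.smul_eq_C_mul, sub_eq_add_neg]
  refine hhalf.le_signChanges hr (d := d) (fun i => ?_) (by rw [hμr, hμ0]) ?_ ?_
  · induction i using Fin.lastCases with
    | last => simp [hμr, hlam]
    | cast i => simp [hμ, hlam]
  · rw [hsum]
    exact BinaryForm.aeval_X_one_ne_zero hhom hp0
  · rw [hsum]
    exact BinaryForm.hasLinearFactors_aeval hhom hp0 he hfac
end

section
/- If a real binary form p of degree 2s splits as a product of 2s real linear forms and p is not ±ℓ^{2s} for a single linear form ℓ, then any honest representation p = Σ_k λ_k (α_k x + β_k y)^{2s} with nonzero λ_k and pairwise non-proportional linear forms has at least s positive coefficients and at least s negative coefficients. -/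
open MvPolynomial

/-- A function of two real variables is a real multiple of a product of `d` real linear forms. -/
def IsLinearProduct (d : ℕ) (F : ℝ → ℝ → ℝ) : Prop :=
  ∃ (c : ℝ) (m : Multiset (ℝ × ℝ)), m.card = d ∧
    ∀ x y, F x y = c * (m.map fun q => q.1 * x + q.2 * y).prod

/-- The binary form `∑ k, μ k * (α k * x + β k * y) ^ d`. -/
def powSum {r : ℕ} (μ α β : Fin r → ℝ) (d : ℕ) (x y : ℝ) : ℝ :=
  ∑ k, μ k * (α k * x + β k * y) ^ d

theorem IsLinearProduct.comp_linear {d : ℕ} {F : ℝ → ℝ → ℝ} (h : IsLinearProduct d F)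
    (a b a' b' : ℝ) : IsLinearProduct d fun x y => F (a * x + a' * y) (b * x + b' * y) := by
  obtain ⟨c, m, hm, hF⟩ := h
  refine ⟨c, m.map fun q => (q.1 * a + q.2 * b, q.1 * a' + q.2 * b'), by simpa using hm, ?_⟩
  intro x y
  simp only [hF, Multiset.map_map]
  congr 2
  refine Multiset.map_congr rfl fun q _ => ?_
  simp only [Function.comp]
  ring

theorem IsLinearProduct.const_mul {d : ℕ} {F : ℝ → ℝ → ℝ} (h : IsLinearProduct d F)
    (a : ℝ) : IsLinearProduct d fun x y => a * F x y := by
  obtain ⟨c, m, hm, hF⟩ := h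
  exact ⟨a * c, m, hm, fun x y => by simp only [hF, mul_assoc]⟩

theorem IsLinearProduct.exists_zero {d : ℕ} {F : ℝ → ℝ → ℝ} (h : IsLinearProduct d F)
    (hd : d ≠ 0) : ∃ x y, (x ≠ 0 ∨ y ≠ 0) ∧ F x y = 0 := by
  obtain ⟨c, m, hm, hF⟩ := h
  obtain ⟨q, hq⟩ := Multiset.card_pos_iff_exists_mem.1 (by omega : 0 < m.card)
  by_cases h0 : q.1 = 0 ∧ q.2 = 0
  · refine ⟨1, 0, by simp, ?_⟩
    rw [hF, Multiset.prod_eq_zero, mul_zero]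
    exact Multiset.mem_map.2 ⟨q, hq, by simp [h0]⟩
  · refine ⟨-q.2, q.1, by rw [neg_ne_zero]; tauto, ?_⟩
    rw [hF, Multiset.prod_eq_zero, mul_zero]
    exact Multiset.mem_map.2 ⟨q, hq, by ring⟩

/-- The derivative of a polynomial that splits over the reals splits over the reals. -/
theorem Polynomial.Splits.derivative_real {P : Polynomial ℝ} (h : P.Splits) :
    P.derivative.Splits := by
  rcases Nat.eq_zero_or_pos P.natDegree with h0 | h0
  · rw [Polynomial.eq_C_of_natDegree_eq_zero h0]
    simp
  · rw [Polynomial.splits_iff_card_roots] at h ⊢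
    have h1 := P.card_roots_le_derivative
    have h2 := P.derivative.card_roots'
    have h3 := Polynomial.natDegree_derivative_lt h0.ne'
    omega

/-- Homogenizing a split real polynomial of degree at most `d` gives a product of `d` linear
forms. -/
theorem IsLinearProduct.of_splits {d : ℕ} {Q : Polynomial ℝ} (hQ : Q.Splits)
    (hd : Q.natDegree ≤ d) {G : ℝ → ℝ → ℝ} (hG : ∀ x, Continuous (G x))
    (h : ∀ x y, y ≠ 0 → G x y = y ^ d * Q.eval (x / y)) : IsLinearProduct d G := by
  have hcard := Polynomial.splits_iff_card_roots.1 hQ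
  refine ⟨Q.leadingCoeff, Q.roots.map (fun a => (1, -a)) +
    Multiset.replicate (d - Q.natDegree) (0, 1), by simp [hcard, hd], fun x => ?_⟩
  rw [← funext_iff]
  refine Continuous.ext_on (dense_compl_singleton (0 : ℝ)) (hG x) ?_ fun y hy => ?_
  · refine continuous_const.mul ?_
    exact continuous_multiset_prod _ fun q _ => by fun_prop
  · have hy : y ≠ 0 := hy
    have key : (Q.roots.map fun a => 1 * x + -a * y).prod =
        y ^ Q.natDegree * (Q.roots.map fun a => x / y - a).prod := by
      rw [← hcard, ← Multiset.prod_replicate, ← Multiset.map_const', ← Multiset.prod_map_mul]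
      congr 1
      refine Multiset.map_congr rfl fun a _ => ?_
      field_simp
      ring
    rw [h x y hy, hQ.eval_eq_prod_roots]
    simp only [Multiset.map_add, Multiset.prod_add, Multiset.map_map, Function.comp_def, key,
      Multiset.map_replicate, Multiset.prod_replicate]
    conv_lhs => rw [← Nat.sub_add_cancel hd, pow_add]
    ring

theorem IsLinearProduct.powSum_deriv_fst {r d : ℕ} {μ α β : Fin r → ℝ}
    (h : IsLinearProduct (d + 1) (powSum μ α β (d + 1))) :
    IsLinearProduct d (powSum (fun k => μ k * α k) α β d) := by
  obtain ⟨c, m, hm, hF⟩ := h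
  let P : Polynomial ℝ := ∑ k, Polynomial.C (μ k) *
    (Polynomial.C (α k) * Polynomial.X + Polynomial.C (β k)) ^ (d + 1)
  have hP : P = Polynomial.C c *
      (m.map fun q => Polynomial.C q.1 * Polynomial.X + Polynomial.C q.2).prod := by
    refine Polynomial.funext fun x => ?_
    have := hF x 1
    simp only [powSum, mul_one] at this
    simp [P, Polynomial.eval_finsetSum, this, Polynomial.eval_multiset_prod]
  have hsp : P.Splits := by
    rw [hP]
    refine (Polynomial.Splits.multisetProd fun f hf => ?_).C_mul c
    obtain ⟨q, -, rfl⟩ := Multiset.mem_map.1 hf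
    exact Polynomial.Splits.of_natDegree_le_one Polynomial.natDegree_linear_le
  have hdeg : P.natDegree ≤ d + 1 := by
    refine Polynomial.natDegree_sum_le_of_forall_le _ _ fun k _ => ?_
    refine (Polynomial.natDegree_C_mul_le _ _).trans (Polynomial.natDegree_pow_le.trans ?_)
    have := Polynomial.natDegree_linear_le (a := α k) (b := β k)
    nlinarith
  have key : IsLinearProduct d
      fun x y => (d + 1 : ℝ) * powSum (fun k => μ k * α k) α β d x y := by
    refine .of_splits hsp.derivative_real
      ((Polynomial.natDegree_derivative_le P).trans (by omega)) ?_ ?_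
    · intro x
      unfold powSum
      fun_prop
    · intro x y hy
      simp only [powSum, P, Polynomial.derivative_sum, Polynomial.eval_finsetSum,
        Finset.mul_sum]
      refine Finset.sum_congr rfl fun k _ => ?_
      have : α k * x + β k * y = y * (α k * (x / y) + β k) := by field_simp
      rw [this, mul_pow]
      simp [Polynomial.derivative_pow]
      ring
  have h2 := key.const_mul (d + 1 : ℝ)⁻¹
  have h3 : (d + 1 : ℝ) ≠ 0 := by positivity
  simpa [inv_mul_cancel_left₀ h3] using h2

/-- Directional derivatives of a product of linear forms, for sums of powers. -/
theorem IsLinearProduct.powSum_deriv {r d : ℕ} {μ α β : Fin r → ℝ}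
    (h : IsLinearProduct (d + 1) (powSum μ α β (d + 1))) (u v : ℝ) :
    IsLinearProduct d (powSum (fun k => μ k * (α k * u + β k * v)) α β d) := by
  by_cases h0 : u = 0 ∧ v = 0
  · refine ⟨0, Multiset.replicate d (0, 0), by simp, fun x y => ?_⟩
    simp [powSum, h0]
  have hn : u ^ 2 + v ^ 2 ≠ 0 := by
    intro hn
    exact h0 ⟨by nlinarith [sq_nonneg u, sq_nonneg v], by nlinarith [sq_nonneg u, sq_nonneg v]⟩
  have h1 := h.comp_linear u v (-v) u
  have h2 : IsLinearProduct (d + 1) (powSum μ (fun k => α k * u + β k * v)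
      (fun k => α k * (-v) + β k * u) (d + 1)) := by
    convert h1 using 3 with x y
    refine Finset.sum_congr rfl fun k _ => ?_
    ring
  have h3 := h2.powSum_deriv_fst.comp_linear (u / (u ^ 2 + v ^ 2)) (-v / (u ^ 2 + v ^ 2))
    (v / (u ^ 2 + v ^ 2)) (u / (u ^ 2 + v ^ 2))
  convert h3 using 3 with x y
  refine Finset.sum_congr rfl fun k _ => ?_
  congr 2
  field_simp
  ring

theorem IsLinearProduct.powSum_deriv_deriv {r d : ℕ} {μ α β : Fin r → ℝ}
    (h : IsLinearProduct (d + 2) (powSum μ α β (d + 2))) (u v u' v' : ℝ) :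
    IsLinearProduct d (powSum
      (fun k => μ k * ((α k * u + β k * v) * (α k * u' + β k * v'))) α β d) := by
  simpa only [mul_assoc] using (h.powSum_deriv u v).powSum_deriv u' v'

/-- Applying the squares of the operators that annihilate the forms indexed by `S`. -/
theorem IsLinearProduct.powSum_annihilate {r d : ℕ} {μ α β : Fin r → ℝ} (S : Finset (Fin r))
    (h : IsLinearProduct (d + 2 * S.card) (powSum μ α β (d + 2 * S.card))) :
    IsLinearProduct d
      (powSum (fun k => μ k * ∏ j ∈ S, (α k * β j - α j * β k) ^ 2) α β d) := by
  induction S using Finset.induction_on generalizing μ with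
  | empty => simpa using h
  | insert a S ha ih =>
    rw [Finset.card_insert_of_notMem ha] at h
    have := ih (h.powSum_deriv_deriv (β a) (-α a) (β a) (-α a))
    convert this using 3 with k
    rw [Finset.prod_insert ha]
    ring

/-- An even power sum with nonnegative coefficients that is a product of linear forms involves
at most one form. -/
theorem IsLinearProduct.eq_of_nonneg {r d : ℕ} {μ α β : Fin r → ℝ}
    (h : IsLinearProduct d (powSum μ α β d)) (hd : Even d) (hd0 : d ≠ 0) (hμ : ∀ k, 0 ≤ μ k)
    (hdist : ∀ k l, k ≠ l → α k * β l - α l * β k ≠ 0) {k l : Fin r}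
    (hk : μ k ≠ 0) (hl : μ l ≠ 0) : k = l := by
  obtain ⟨x, y, hxy, h0⟩ := h.exists_zero hd0
  have hz := (Finset.sum_eq_zero_iff_of_nonneg
    fun j _ => mul_nonneg (hμ j) (hd.pow_nonneg _)).1 h0
  have hlin : ∀ j, μ j ≠ 0 → α j * x + β j * y = 0 := fun j hj =>
    eq_zero_of_pow_eq_zero ((mul_eq_zero.1 (hz j (Finset.mem_univ j))).resolve_left hj)
  by_contra hkl
  have hdet := hdist k l hkl
  have h1 := hlin k hk
  have h2 := hlin l hl
  rcases hxy with hx | hy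
  · exact mul_ne_zero hdet hx (by linear_combination β l * h1 - β k * h2)
  · exact mul_ne_zero hdet hy (by linear_combination α k * h2 - α l * h1)

/-- If fewer than `s` coefficients are negative, then at most one is positive. -/
theorem IsLinearProduct.eq_of_card_neg_lt {r s : ℕ} {μ α β : Fin r → ℝ}
    (h : IsLinearProduct (2 * s) (powSum μ α β (2 * s)))
    (hdist : ∀ k l, k ≠ l → α k * β l - α l * β k ≠ 0)
    (hcard : (Finset.univ.filter fun k => μ k < 0).card < s) {k l : Fin r}
    (hk : 0 < μ k) (hl : 0 < μ l) : k = l := by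
  set S := Finset.univ.filter fun k => μ k < 0 with hS
  have hs : 2 * s = 2 * (s - S.card) + 2 * S.card := by omega
  rw [hs] at h
  have hne : ∀ m, 0 < μ m → μ m * ∏ j ∈ S, (α m * β j - α j * β m) ^ 2 ≠ 0 := by
    refine fun m hm => mul_ne_zero hm.ne' (Finset.prod_ne_zero_iff.2 fun j hj => ?_)
    refine pow_ne_zero _ (hdist m j ?_)
    rintro rfl
    exact absurd (Finset.mem_filter.1 hj).2 hm.not_gt
  refine h.powSum_annihilate.eq_of_nonneg (even_two_mul _) (by omega) (fun m => ?_) hdist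
    (hne k hk) (hne l hl)
  by_cases hm : μ m < 0
  · rw [Finset.prod_eq_zero (i := m) (by simp [hS, hm]) (by ring), mul_zero]
  · exact mul_nonneg (not_lt.1 hm) (Finset.prod_nonneg fun j _ => sq_nonneg _)

/-- A difference of two positive multiples of powers of degree at least four is not a product of
linear forms. -/
theorem IsLinearProduct.false_of_pos_neg {r s : ℕ} {μ α β : Fin r → ℝ} (hs : 2 ≤ s)
    (h : IsLinearProduct (2 * s) (powSum μ α β (2 * s)))
    (hdist : ∀ k l, k ≠ l → α k * β l - α l * β k ≠ 0) {k l : Fin r}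
    (hk : 0 < μ k) (hl : μ l < 0) (hkl : ∀ m, m = k ∨ m = l) : False := by
  have hne : k ≠ l := by
    rintro rfl
    exact hk.not_gt hl
  have hdet := hdist k l hne
  set D := α k * β l - α l * β k with hD
  obtain ⟨t, rfl⟩ : ∃ t, s = t + 2 := ⟨s - 2, by omega⟩
  have h' : IsLinearProduct (2 * (t + 1) + 2) (powSum μ α β (2 * (t + 1) + 2)) := h
  have h2 := h'.powSum_deriv_deriv ((β l - β k) / D) ((α k - α l) / D)
    ((β l + β k) / D) ((-α k - α l) / D)
  have hck : (α k * ((β l - β k) / D) + β k * ((α k - α l) / D)) *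
      (α k * ((β l + β k) / D) + β k * ((-α k - α l) / D)) = 1 := by
    field_simp
    rw [hD]
    ring
  have hcl : (α l * ((β l - β k) / D) + β l * ((α k - α l) / D)) *
      (α l * ((β l + β k) / D) + β l * ((-α k - α l) / D)) = -1 := by
    field_simp
    rw [hD]
    ring
  refine hne (h2.eq_of_nonneg (even_two_mul _) (by omega) (fun m => ?_) hdist ?_ ?_)
  · rcases hkl m with rfl | rfl
    · rw [hck]
      linarith
    · rw [hcl]
      linarith
  · rw [hck]
    linarith
  · rw [hcl]
    linarith

theorem IsLinearProduct.powSum_neg {r d : ℕ} {μ α β : Fin r → ℝ}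
    (h : IsLinearProduct d (powSum μ α β d)) :
    IsLinearProduct d (powSum (fun k => -μ k) α β d) := by
  convert h.const_mul (-1) using 3 with x y
  simp [powSum]

/-- If fewer than `s` coefficients are negative, then at most one form occurs. -/
theorem IsLinearProduct.le_one_of_card_neg_lt {r s : ℕ} {μ α β : Fin r → ℝ}
    (h : IsLinearProduct (2 * s) (powSum μ α β (2 * s))) (hμ : ∀ k, μ k ≠ 0)
    (hdist : ∀ k l, k ≠ l → α k * β l - α l * β k ≠ 0)
    (hcard : (Finset.univ.filter fun k => μ k < 0).card < s) : r ≤ 1 := by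
  by_contra! hr
  have hpos : ∀ k l, 0 < μ k → 0 < μ l → k = l :=
    fun k l hk hl => h.eq_of_card_neg_lt hdist hcard hk hl
  have hsign : ∀ m, 0 < μ m ∨ μ m < 0 := fun m => (hμ m).lt_or_gt.symm
  have hne : (⟨0, by omega⟩ : Fin r) ≠ ⟨1, hr⟩ := by simp
  obtain ⟨l, hl⟩ : ∃ l, μ l < 0 := by
    by_contra! hnn
    exact hne (hpos _ _ ((hsign _).resolve_right (hnn _).not_gt)
      ((hsign _).resolve_right (hnn _).not_gt))
  have hs : 2 ≤ s := by
    have : 0 < (Finset.univ.filter fun k => μ k < 0).card :=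
      Finset.card_pos.2 ⟨l, by simpa using hl⟩
    omega
  have hneg : ∀ k l, μ k < 0 → μ l < 0 → k = l := by
    intro k l hk hl
    refine h.powSum_neg.eq_of_card_neg_lt hdist (lt_of_le_of_lt ?_ hs) (neg_pos.2 hk)
      (neg_pos.2 hl)
    refine Finset.card_le_one.2 fun a ha b hb => hpos a b ?_ ?_
    · simpa using ha
    · simpa using hb
  obtain ⟨k, hk⟩ : ∃ k, 0 < μ k := by
    by_contra! hnp
    exact hne (hneg _ _ ((hsign _).resolve_left (hnp _).not_gt)
      ((hsign _).resolve_left (hnp _).not_gt))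
  exact h.false_of_pos_neg hs hdist hk hl fun m =>
    (hsign m).imp (fun hm => hpos m k hm hk) (fun hm => hneg m l hm hl)

theorem exists_eq_pow_or_neg_pow {n : ℕ} (hn : n ≠ 0) (a : ℝ) :
    ∃ t : ℝ, a = t ^ n ∨ a = -t ^ n := by
  refine ⟨|a| ^ (n : ℝ)⁻¹, ?_⟩
  rw [Real.rpow_inv_natCast_pow (abs_nonneg a) hn]
  rcases abs_cases a with h | h
  · exact .inl h.1.symm
  · exact .inr (by linarith [h.1])

theorem stmt5 (s : ℕ) (hs : 1 ≤ s) (p : MvPolynomial (Fin 2) ℝ)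
    (e f : Fin (2*s) → ℝ) (he : ∀ i, (e i, f i) ≠ (0, 0))
    (hsplit : p = ∏ i : Fin (2*s), (e i • X 0 + f i • X 1 : MvPolynomial (Fin 2) ℝ))
    (hnotpow : ¬ ∃ c d : ℝ,
      p = (c • X 0 + d • X 1 : MvPolynomial (Fin 2) ℝ) ^ (2*s) ∨
      p = -(c • X 0 + d • X 1 : MvPolynomial (Fin 2) ℝ) ^ (2*s))
    (r : ℕ) (lam α β : Fin r → ℝ)
    (hlam : ∀ k, lam k ≠ 0)
    (hdist : ∀ k l, k ≠ l → α k * β l - α l * β k ≠ 0)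
    (hrep : p = ∑ k : Fin r,
      lam k • (α k • X 0 + β k • X 1 : MvPolynomial (Fin 2) ℝ) ^ (2*s)) :
    s ≤ Nat.card {k : Fin r // 0 < lam k} ∧ s ≤ Nat.card {k : Fin r // lam k < 0} := by
  have hprod : IsLinearProduct (2 * s) (powSum lam α β (2 * s)) := by
    refine ⟨1, Finset.univ.val.map fun i => (e i, f i), by simp, fun x y => ?_⟩
    have := congrArg (MvPolynomial.eval ![x, y]) (hrep.symm.trans hsplit)
    rw [one_mul, Multiset.map_map]
    change _ = ∏ i, (e i * x + f i * y)
    simpa [powSum, smul_eval, eval_prod] using this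
  have hr : ¬ r ≤ 1 := by
    intro hr
    refine hnotpow ?_
    obtain rfl | rfl : r = 0 ∨ r = 1 := by omega
    · refine ⟨0, 0, .inl ?_⟩
      rw [hrep]
      simp [show s ≠ 0 by omega]
    · obtain ⟨t, ht⟩ := exists_eq_pow_or_neg_pow (n := 2 * s) (by omega) (lam 0)
      refine ⟨t * α 0, t * β 0, ?_⟩
      rw [mul_smul, mul_smul, ← smul_add, smul_pow, hrep, Fin.sum_univ_one, ← neg_smul]
      exact ht.imp (fun h => by rw [h]) (fun h => by rw [h])
  rw [Nat.card_eq_fintype_card, Fintype.card_subtype, Nat.card_eq_fintype_card,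
    Fintype.card_subtype]
  constructor
  · by_contra! hlt
    refine hr (hprod.powSum_neg.le_one_of_card_neg_lt (fun k => neg_ne_zero.2 (hlam k)) hdist ?_)
    simpa using hlt
  · by_contra! hlt
    exact hr (hprod.le_one_of_card_neg_lt hlam hdist hlt)
end

section
/- For s ≥ 1, any honest representation of a binary form p of degree 2s that is a badge-minimal representation must have a ≤ s+1 and b ≤ s+1; moreover if (s+1, b) is a signature then b = 0, and if (a, s+1) is a signature then a = 0. Hence every signature of p lies in {(s+1,0),(0,s+1)} ∪ [0,s]². -/
open MvPolynomial

/-- An honest representation of `p` as a linear combination of `2s`-th powers of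
pairwise non-proportional real binary linear forms. -/
def IsHonestRep (s r : ℕ) (p : MvPolynomial (Fin 2) ℝ)
    (lam α β : Fin r → ℝ) : Prop :=
  (∀ k, lam k ≠ 0) ∧
  (∀ k l, k ≠ l → α k * β l - α l * β k ≠ 0) ∧
  p = ∑ k : Fin r, lam k • (α k • X 0 + β k • X 1 : MvPolynomial (Fin 2) ℝ) ^ (2*s)

/-- The set of badges `(a,b)` of honest representations of `p`, where `a` counts
positive and `b` negative coefficients. -/
def badges (s : ℕ) (p : MvPolynomial (Fin 2) ℝ) : Set (ℕ × ℕ) :=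
  { ab | ∃ (r : ℕ) (lam α β : Fin r → ℝ), IsHonestRep s r p lam α β ∧
      ab.1 = Nat.card {k : Fin r // 0 < lam k} ∧
      ab.2 = Nat.card {k : Fin r // lam k < 0} }

/-- A signature of `p` is a minimal badge under the componentwise order. -/
def IsSignature (s : ℕ) (p : MvPolynomial (Fin 2) ℝ) (ab : ℕ × ℕ) : Prop :=
  ab ∈ badges s p ∧ ∀ cd ∈ badges s p, cd.1 ≤ ab.1 → cd.2 ≤ ab.2 → cd = ab

/-- Gauss quadrature: moments up to order `2s-1` of a nonnegative finite measure are those of a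
nonnegative measure with at most `s` atoms, whose moment of order `2s` is not larger. -/
theorem exists_quadrature {ι : Type*} [Fintype ι] (s : ℕ) (hs : 1 ≤ s) (w x : ι → ℝ)
    (hw : ∀ k, 0 ≤ w k) :
    ∃ (d : ℕ) (μ θ : Fin d → ℝ), d ≤ s ∧ (∀ j, 0 ≤ μ j) ∧
      (∀ n < 2 * s, ∑ k, w k * x k ^ n = ∑ j, μ j * θ j ^ n) ∧
      ∑ j, μ j * θ j ^ (2 * s) ≤ ∑ k, w k * x k ^ (2 * s) := by
  classical
  let v : ℕ → EuclideanSpace ℝ ι := fun i => WithLp.toLp 2 fun k => √(w k) * x k ^ i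
  have hv : ∀ i j, inner ℝ (v i) (v j) = ∑ k, w k * x k ^ (i + j) := by
    intro i j
    simp only [v, PiLp.inner_apply]
    refine Finset.sum_congr rfl fun k _ => ?_
    simp only [RCLike.inner_apply, conj_trivial]
    nth_rewrite 3 [← Real.mul_self_sqrt (hw k)]
    ring
  let M : EuclideanSpace ℝ ι →ₗ[ℝ] EuclideanSpace ℝ ι :=
    { toFun := fun y => WithLp.toLp 2 fun k => x k * y k
      map_add' := fun y z => by ext k; simp [mul_add]
      map_smul' := fun c y => by ext k; simp [mul_left_comm] }
  have hM : M.IsSymmetric := by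
    intro y z
    simp only [M, PiLp.inner_apply, LinearMap.coe_mk, AddHom.coe_mk]
    refine Finset.sum_congr rfl fun k _ => ?_
    simp only [RCLike.inner_apply, conj_trivial]
    ring
  have hMv : ∀ i, M (v i) = v (i + 1) := by
    intro i
    ext k
    simp only [M, v, LinearMap.coe_mk, AddHom.coe_mk]
    ring
  let H : Submodule ℝ (EuclideanSpace ℝ ι) := Submodule.span ℝ (Set.range fun i : Fin s => v i)
  have hvH : ∀ i < s, v i ∈ H := fun i hi => Submodule.subset_span ⟨⟨i, hi⟩, rfl⟩
  let P : EuclideanSpace ℝ ι →ₗ[ℝ] H := (H.orthogonalProjectionOnto : _ →L[ℝ] H).toLinearMap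
  have hP : ∀ (y : H) (z : EuclideanSpace ℝ ι), inner ℝ y (P z) = inner ℝ (y : EuclideanSpace ℝ ι) z :=
    fun y z => Submodule.inner_orthogonalProjectionOnto_eq_of_mem_left y z
  have hPmem : ∀ y : H, P y = y := fun y => Submodule.orthogonalProjectionOnto_mem_subspace_eq_self y
  let A : H →ₗ[ℝ] H := P ∘ₗ M ∘ₗ H.subtype
  have hA : A.IsSymmetric := by
    intro y z
    have h1 : inner ℝ y (A z) = inner ℝ (y : EuclideanSpace ℝ ι) (M z) := hP _ _
    have h2 : inner ℝ (A y) z = inner ℝ (M y) (z : EuclideanSpace ℝ ι) := by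
      rw [real_inner_comm, real_inner_comm (z : EuclideanSpace ℝ ι)]; exact hP _ _
    rw [h1, h2, hM]
  have hpow : ∀ i ≤ s, (A ^ i) (P (v 0)) = P (v i) := by
    intro i
    induction i with
    | zero => intro _; rfl
    | succ i ih =>
      intro hi
      rw [pow_succ', Module.End.mul_apply, ih (by omega)]
      have := hPmem ⟨v i, hvH i (by omega)⟩
      simp only at this
      rw [this]
      simp [A, hMv]
  have hn : Module.finrank ℝ H = Module.finrank ℝ H := rfl
  let b := hA.eigenvectorBasis hn
  let θ := hA.eigenvalues hn
  have hb : ∀ n j, (A ^ n) (b j) = (θ j ^ n) • b j := by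
    intro n j
    induction n with
    | zero => simp
    | succ n ih =>
      rw [pow_succ, Module.End.mul_apply, hA.apply_eigenvectorBasis hn j, map_smul]
      erw [ih]
      rw [smul_smul]
      congr 1
      rw [pow_succ']; rfl
  have hApow : ∀ n, (A ^ n).IsSymmetric := fun n => hA.pow n
  set e := P (v 0) with he
  have hbe : ∀ n j, inner ℝ (b j) ((A ^ n) e) = θ j ^ n * inner ℝ (b j) e := by
    intro n j
    rw [← hApow n, hb]
    exact real_inner_smul_left (b j) e _
  have hmom : ∀ i j, inner ℝ ((A ^ i) e) ((A ^ j) e) =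
      ∑ k, inner ℝ (b k) e ^ 2 * θ k ^ (i + j) := by
    intro i j
    rw [← b.sum_inner_mul_inner]
    refine Finset.sum_congr rfl fun k _ => ?_
    rw [real_inner_comm, hbe, hbe]
    ring
  refine ⟨Module.finrank ℝ H, fun j => inner ℝ (b j) e ^ 2, θ, ?_, fun j => sq_nonneg _, ?_, ?_⟩
  · exact (finrank_range_le_card (R := ℝ) fun i : Fin s => v i).trans_eq (Fintype.card_fin s)
  · intro n hns
    obtain ⟨i, j, hi, hj, rfl⟩ : ∃ i j, i < s ∧ j ≤ s ∧ n = i + j :=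
      ⟨min n (s - 1), n - min n (s - 1), by omega, by omega, by omega⟩
    rw [← hmom, hpow i hi.le, hpow j hj, hP, ← hv]
    have := hPmem ⟨v i, hvH i hi⟩
    simp only at this
    rw [this]
  · rw [two_mul, ← hmom, ← hv, hpow s le_rfl, real_inner_self_eq_norm_sq,
      real_inner_self_eq_norm_sq]
    gcongr
    exact Submodule.norm_orthogonalProjectionOnto_apply_le H (v s)

theorem sum_smul_add_pow {R κ : Type*} [CommRing R] [Algebra ℝ R] [Fintype κ] (n : ℕ)
    (w x : κ → ℝ) (m l : R) :
    ∑ k, w k • (x k • l + m) ^ n = (∑ k, w k * x k ^ n) • l ^ n +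
      ∑ i ∈ Finset.range n, (∑ k, w k * x k ^ i) • (l ^ i * m ^ (n - i) * (n.choose i : R)) := by
  have h : ∀ k, w k • (x k • l + m) ^ n = ∑ i ∈ Finset.range (n + 1),
      (w k * x k ^ i) • (l ^ i * m ^ (n - i) * (n.choose i : R)) := by
    intro k
    rw [add_pow, Finset.smul_sum]
    refine Finset.sum_congr rfl fun i _ => ?_
    rw [smul_pow, smul_mul_assoc, smul_mul_assoc, smul_smul]
  simp_rw [h]
  rw [Finset.sum_comm, Finset.sum_range_succ, add_comm]
  simp only [← Finset.sum_smul]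
  simp

/-- A sum of powers `(m + x ℓ)^(2s)` with nonnegative weights is a nonnegative multiple of
`ℓ^(2s)` plus at most `s` such powers. -/
theorem exists_sum_pow_eq {R ι : Type*} [CommRing R] [Algebra ℝ R] [Fintype ι] (s : ℕ)
    (hs : 1 ≤ s) (w x : ι → ℝ) (hw : ∀ k, 0 ≤ w k) (m l : R) :
    ∃ (c : ℝ) (d : ℕ) (μ θ : Fin d → ℝ), 0 ≤ c ∧ d ≤ s ∧ (∀ j, 0 ≤ μ j) ∧
      ∑ k, w k • (x k • l + m) ^ (2 * s) =
        c • l ^ (2 * s) + ∑ j, μ j • (θ j • l + m) ^ (2 * s) := by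
  obtain ⟨d, μ, θ, hd, hμ, heq, hle⟩ := exists_quadrature s hs w x hw
  refine ⟨_, d, μ, θ, sub_nonneg.2 hle, hd, hμ, ?_⟩
  rw [sum_smul_add_pow, sum_smul_add_pow _ μ, sub_smul,
    Finset.sum_congr (s₁ := Finset.range (2 * s)) rfl fun n hn => by
      rw [heq n (Finset.mem_range.1 hn)]]
  abel

/-- A nonnegative combination of `2s`-th powers of linear forms is a nonnegative multiple of the
`2s`-th power of a prescribed form plus a nonnegative combination of at most `s` powers. -/
theorem exists_sum_linear_pow_eq {ι : Type*} [Fintype ι] (s : ℕ) (hs : 1 ≤ s)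
    (w α β : ι → ℝ) (hw : ∀ k, 0 ≤ w k) (u v : ℝ) (huv : u ≠ 0 ∨ v ≠ 0) :
    ∃ (c : ℝ) (d : ℕ) (μ γ δ : Fin d → ℝ), 0 ≤ c ∧ d ≤ s ∧ (∀ j, 0 ≤ μ j) ∧
      ∑ k, w k • (α k • X 0 + β k • X 1 : MvPolynomial (Fin 2) ℝ) ^ (2 * s) =
        c • (u • X 0 + v • X 1) ^ (2 * s) +
          ∑ j, μ j • (γ j • X 0 + δ j • X 1 : MvPolynomial (Fin 2) ℝ) ^ (2 * s) := by
  classical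
  have hD : u ^ 2 + v ^ 2 ≠ 0 := by
    rcases huv with h | h
    · have := sq_pos_of_ne_zero h; positivity
    · have := sq_pos_of_ne_zero h; positivity
  set l : MvPolynomial (Fin 2) ℝ := u • X 0 + v • X 1 with hl
  set m : MvPolynomial (Fin 2) ℝ := (-v) • X 0 + u • X 1 with hm
  let y : ι → ℝ := fun k => (-α k * v + β k * u) / (u ^ 2 + v ^ 2)
  let z : ι → ℝ := fun k => (α k * u + β k * v) / (u ^ 2 + v ^ 2)
  have hlin : ∀ k, (α k • X 0 + β k • X 1 : MvPolynomial (Fin 2) ℝ) = z k • l + y k • m := by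
    intro k
    have h0 : α k = z k * u + y k * -v := by simp only [y, z]; field_simp; ring
    have h1 : β k = z k * v + y k * u := by simp only [y, z]; field_simp; ring
    rw [hl, hm]
    nth_rewrite 1 [h0, h1]
    module
  obtain ⟨c, d, μ, θ, hc, hd, hμ, h⟩ := exists_sum_pow_eq s hs (fun k => w k * y k ^ (2 * s))
    (fun k => z k / y k) (fun k => mul_nonneg (hw k) ((even_two_mul s).pow_nonneg _)) m l
  have hterm : ∀ k, w k • (z k • l + y k • m) ^ (2 * s) =
      (w k * y k ^ (2 * s)) • ((z k / y k) • l + m) ^ (2 * s) +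
        (if y k = 0 then w k * z k ^ (2 * s) else 0) • l ^ (2 * s) := by
    intro k
    split_ifs with hy
    · rw [hy, zero_pow (by omega), zero_smul, mul_zero, zero_smul, add_zero, zero_add, smul_pow,
        smul_smul]
    · have h : y k • ((z k / y k) • l + m) = z k • l + y k • m := by
        rw [smul_add (y k) ((z k / y k) • l) m, smul_smul (y k) (z k / y k) l,
          mul_div_cancel₀ _ hy]
      rw [zero_smul, add_zero, mul_smul, ← smul_pow, h]
  refine ⟨c + ∑ k, if y k = 0 then w k * z k ^ (2 * s) else 0, d, μ, fun j => θ j * u - v,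
    fun j => θ j * v + u, add_nonneg hc (Finset.sum_nonneg fun k _ => ?_), hd, hμ, ?_⟩
  · split_ifs
    · exact mul_nonneg (hw k) ((even_two_mul s).pow_nonneg _)
    · exact le_rfl
  · simp_rw [hlin, hterm]
    rw [Finset.sum_add_distrib, h, ← Finset.sum_smul, add_smul]
    have : ∀ j, θ j • l + m = (θ j * u - v) • X 0 + (θ j * v + u) • X 1 := by
      intro j
      rw [hl, hm]
      module
    simp_rw [this]
    abel

theorem card_filter_pos_merge_le {ι : Type*} [Fintype ι] [DecidableEq ι] (lam : ι → ℝ) {k l : ι}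
    (hkl : k ≠ l) {q : ℝ} (hq : 0 ≤ q) :
    (Finset.univ.filter fun i => 0 < lam i + (if i = k then q * lam l else 0) -
      (if i = l then lam l else 0)).card ≤ (Finset.univ.filter fun i => 0 < lam i).card := by
  by_cases hl : 0 < lam l
  · have hmem : l ∈ Finset.univ.filter fun i => 0 < lam i := by simpa using hl
    refine (Finset.card_le_card (t := insert k ((Finset.univ.filter fun i => 0 < lam i).erase l))
      fun i hi => ?_).trans ((Finset.card_insert_le _ _).trans
        (Finset.card_erase_add_one hmem).le)
    simp only [Finset.mem_filter, Finset.mem_univ, true_and, Finset.mem_insert,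
      Finset.mem_erase] at hi ⊢
    by_cases h1 : i = k
    · exact Or.inl h1
    · by_cases h2 : i = l
      · subst h2; simp [h1] at hi
      · simp only [h1, h2, if_false] at hi
        exact Or.inr ⟨h2, by linarith⟩
  · refine Finset.card_le_card fun i hi => ?_
    simp only [Finset.mem_filter, Finset.mem_univ, true_and] at hi ⊢
    by_cases h2 : i = l
    · subst h2; simp [hkl.symm] at hi
    · by_cases h1 : i = k
      · simp only [h1, hkl, if_true, if_false] at hi ⊢
        nlinarith
      · simpa [h1, h2] using hi

theorem exists_eq_mul_of_det_eq_zero {a b c d : ℝ} (h : a * d - c * b = 0) (hab : a ≠ 0 ∨ b ≠ 0) :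
    ∃ t, c = t * a ∧ d = t * b := by
  rcases hab with h0 | h0
  · exact ⟨c / a, by field_simp, by field_simp; linarith⟩
  · exact ⟨d / b, by field_simp; linarith, by field_simp⟩

/-- The coefficients of a linear combination of `2s`-th powers of linear forms can be modified so
that the forms with nonzero coefficient are pairwise non-proportional, without increasing the
number of positive or negative coefficients. -/
theorem exists_nonproportional {ι : Type*} [Fintype ι] (s : ℕ) (α β : ι → ℝ)
    (lam : ι → ℝ) :
    ∃ lam' : ι → ℝ,
      ∑ k, lam' k • (α k • X 0 + β k • X 1 : MvPolynomial (Fin 2) ℝ) ^ (2 * s) =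
        ∑ k, lam k • (α k • X 0 + β k • X 1 : MvPolynomial (Fin 2) ℝ) ^ (2 * s) ∧
      (Finset.univ.filter fun i => 0 < lam' i).card ≤
        (Finset.univ.filter fun i => 0 < lam i).card ∧
      (Finset.univ.filter fun i => lam' i < 0).card ≤
        (Finset.univ.filter fun i => lam i < 0).card ∧
      ∀ k l, k ≠ l → lam' k ≠ 0 → lam' l ≠ 0 → α k * β l - α l * β k ≠ 0 := by
  classical
  induction hn : (Finset.univ.filter fun i => lam i ≠ 0).card using Nat.strong_induction_on
    generalizing lam with
  | _ n ih =>
  by_cases hgood : ∀ k l, k ≠ l → lam k ≠ 0 → lam l ≠ 0 → α k * β l - α l * β k ≠ 0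
  · exact ⟨lam, rfl, le_rfl, le_rfl, hgood⟩
  obtain ⟨k, l, t, hkl, hk, hl, h0, h1⟩ : ∃ k l t, k ≠ l ∧ lam k ≠ 0 ∧ lam l ≠ 0 ∧
      α l = t * α k ∧ β l = t * β k := by
    push Not at hgood
    obtain ⟨k, l, hkl, hk, hl, hdet⟩ := hgood
    by_cases hz : α k ≠ 0 ∨ β k ≠ 0
    · obtain ⟨t, h⟩ := exists_eq_mul_of_det_eq_zero hdet hz
      exact ⟨k, l, t, hkl, hk, hl, h⟩
    · push Not at hz
      exact ⟨l, k, 0, hkl.symm, hl, hk, by simp [hz], by simp [hz]⟩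
  have hq : 0 ≤ t ^ (2 * s) := (even_two_mul s).pow_nonneg t
  let lam₁ : ι → ℝ := fun i => lam i + (if i = k then t ^ (2 * s) * lam l else 0) -
    (if i = l then lam l else 0)
  have hsupp : (Finset.univ.filter fun i => lam₁ i ≠ 0).card < n := by
    rw [← hn]
    refine Finset.card_lt_card (Finset.ssubset_iff_of_subset (fun i hi => ?_) |>.2
      ⟨l, by simpa using hl, by simp [lam₁, hkl.symm]⟩)
    simp only [Finset.mem_filter, Finset.mem_univ, true_and] at hi ⊢
    intro hi0
    have hik : i ≠ k := by rintro rfl; exact hk hi0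
    have hil : i ≠ l := by rintro rfl; exact hl hi0
    exact hi (by simp [lam₁, hik, hil, hi0])
  obtain ⟨lam', hsum, hpos, hneg, hdet⟩ := ih _ hsupp lam₁ rfl
  refine ⟨lam', hsum.trans ?_, hpos.trans (card_filter_pos_merge_le lam hkl hq),
    hneg.trans ?_, hdet⟩
  · have hl' : (α l • X 0 + β l • X 1 : MvPolynomial (Fin 2) ℝ) =
        t • (α k • X 0 + β k • X 1) := by
      rw [h0, h1]; module
    simp only [lam₁, add_smul, sub_smul, ite_smul, zero_smul, Finset.sum_add_distrib,
      Finset.sum_sub_distrib, Finset.sum_ite_eq', Finset.mem_univ, if_true]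
    rw [hl', smul_pow]
    module
  · have h := card_filter_pos_merge_le (fun i => -lam i) hkl hq
    have h₂ : ∀ i, (-lam i + (if i = k then t ^ (2 * s) * -lam l else 0) -
        if i = l then -lam l else 0) = -lam₁ i := by
      intro i
      simp only [lam₁]
      split_ifs <;> ring
    simpa only [h₂, neg_pos] using h

/-- Every linear combination of `2s`-th powers of linear forms dominates a badge. -/
theorem exists_mem_badges_le {ι : Type*} [Fintype ι] {s : ℕ} {lam : ι → ℝ}
    (α β : ι → ℝ) {p : MvPolynomial (Fin 2) ℝ}
    (hp : p = ∑ k, lam k • (α k • X 0 + β k • X 1 : MvPolynomial (Fin 2) ℝ) ^ (2 * s))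
    (P N : Finset ι) (hP : ∀ i, 0 < lam i → i ∈ P) (hN : ∀ i, lam i < 0 → i ∈ N) :
    ∃ cd ∈ badges s p, cd.1 ≤ P.card ∧ cd.2 ≤ N.card := by
  classical
  obtain ⟨lam', hsum, hpos, hneg, hdet⟩ := exists_nonproportional s α β lam
  let e := (Fintype.equivFin {i // lam' i ≠ 0}).symm
  refine ⟨(_, _), ⟨_, fun j => lam' (e j), fun j => α (e j), fun j => β (e j),
    ⟨fun j => (e j).2, fun j j' hj => hdet _ _ ?_ (e j).2 (e j').2, ?_⟩, rfl, rfl⟩, ?_, ?_⟩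
  · exact fun h => hj (e.injective (Subtype.ext h))
  · rw [hp, ← hsum, e.sum_comp fun i : {i // lam' i ≠ 0} =>
      lam' i • (α i • X 0 + β i • X 1 : MvPolynomial (Fin 2) ℝ) ^ (2 * s)]
    rw [← Finset.sum_subtype (Finset.univ.filter fun i => lam' i ≠ 0) (by simp) fun i =>
      lam' i • (α i • X 0 + β i • X 1 : MvPolynomial (Fin 2) ℝ) ^ (2 * s)]
    refine (Finset.sum_filter_of_ne (p := fun i => lam' i ≠ 0) fun i _ hi h => hi ?_).symm
    rw [h, zero_smul]
  · refine le_trans ?_ (hpos.trans (Finset.card_le_card fun i hi => hP i (by simpa using hi)))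
    rw [← Fintype.card_subtype, ← Nat.card_eq_fintype_card (α := {i // 0 < lam' i})]
    exact Nat.card_le_card_of_injective (fun j => ⟨e j.1, j.2⟩) fun j j' h =>
      Subtype.ext (e.injective (Subtype.ext (Subtype.mk.inj h)))
  · refine le_trans ?_ (hneg.trans (Finset.card_le_card fun i hi => hN i (by simpa using hi)))
    rw [← Fintype.card_subtype, ← Nat.card_eq_fintype_card (α := {i // lam' i < 0})]
    exact Nat.card_le_card_of_injective (fun j => ⟨e j.1, j.2⟩) fun j j' h =>
      Subtype.ext (e.injective (Subtype.ext (Subtype.mk.inj h)))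

theorem IsSignature.eq_of_lt_fst {s : ℕ} (hs : 1 ≤ s) {p : MvPolynomial (Fin 2) ℝ} {a b : ℕ}
    (h : IsSignature s p (a, b)) (ha : s < a) : a = s + 1 ∧ b = 0 := by
  classical
  obtain ⟨⟨r, lam, α, β, ⟨hlam, hdet, hp⟩, hcard₁, hcard₂⟩, hmin⟩ := h
  simp only [Nat.card_eq_fintype_card, Fintype.card_subtype] at hcard₁ hcard₂
  have hrep := exists_sum_linear_pow_eq s hs (fun k => max (lam k) 0) α β
    (fun k => le_max_right _ _)
  have hp' : p = ∑ k, max (lam k) 0 • (α k • X 0 + β k • X 1 : MvPolynomial (Fin 2) ℝ) ^ (2 * s) +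
      ∑ k, min (lam k) 0 • (α k • X 0 + β k • X 1 : MvPolynomial (Fin 2) ℝ) ^ (2 * s) := by
    rw [hp, ← Finset.sum_add_distrib]
    refine Finset.sum_congr rfl fun k _ => ?_
    rw [← add_smul, max_add_min, add_zero]
  rcases Nat.eq_zero_or_pos b with hb | hb
  · refine ⟨?_, hb⟩
    obtain ⟨c, d, μ, γ, δ, hc, hd, hμ, hsum⟩ := hrep 1 0 (Or.inl one_ne_zero)
    have hnonneg : ∀ k, 0 ≤ lam k := by
      intro k
      by_contra hk
      have : 0 < b := by rw [hcard₂, Finset.card_pos]; exact ⟨k, by simpa using hk⟩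
      omega
    obtain ⟨cd, hcd, h₁, h₂⟩ := exists_mem_badges_le (s := s) (p := p)
      (lam := fun o : Option (Fin d) => o.elim c μ) (fun o => o.elim 1 γ) (fun o => o.elim 0 δ)
      (by rw [hp', hsum]; simp [Fintype.sum_option, hnonneg]) Finset.univ ∅ (by simp)
      (by rintro (_ | j) hj
          · exact absurd hj (not_lt.2 hc)
          · exact absurd hj (not_lt.2 (hμ j)))
    simp only [Finset.card_univ, Fintype.card_option, Fintype.card_fin, Finset.card_empty] at h₁ h₂
    have := hmin cd hcd (by simp only; omega) (by omega)
    rw [this] at h₁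
    simp only at h₁
    omega
  · exfalso
    obtain ⟨k₀, hk₀⟩ := Finset.card_pos.1 (hcard₂ ▸ hb)
    obtain ⟨k₁, hk₁⟩ := Finset.card_pos.1 (hcard₁ ▸ (Nat.zero_le s).trans_lt ha)
    have hk₀' : lam k₀ < 0 := by simpa using hk₀
    have hk₁' : 0 < lam k₁ := by simpa using hk₁
    have hne : α k₀ ≠ 0 ∨ β k₀ ≠ 0 := by
      by_contra! hz
      refine hdet k₀ k₁ ?_ (by simp [hz])
      rintro rfl
      exact lt_asymm hk₀' hk₁'
    obtain ⟨c, d, μ, γ, δ, hc, hd, hμ, hsum⟩ := hrep _ _ hne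
    let lam' : Fin d ⊕ Fin r → ℝ := Sum.elim μ fun k => min (lam k) 0 + if k = k₀ then c else 0
    have hp'' : p = ∑ i, lam' i • (Sum.elim γ α i • X 0 + Sum.elim δ β i • X 1 :
        MvPolynomial (Fin 2) ℝ) ^ (2 * s) := by
      rw [hp', hsum]
      simp only [lam', Fintype.sum_sum_type, Sum.elim_inl, Sum.elim_inr, add_smul, ite_smul,
        zero_smul, Finset.sum_add_distrib, Finset.sum_ite_eq', Finset.mem_univ, if_true]
      abel
    set Q : Finset (Fin d ⊕ Fin r) := Finset.univ.map Function.Embedding.inl with hQ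
    set N : Finset (Fin r) := Finset.univ.filter fun k => lam k < 0 with hNdef
    have hQcard : Q.card = d := by simp [hQ]
    have hother : ∀ k, k ≠ k₀ → ¬ 0 < lam' (Sum.inr k) := by
      intro k hk
      simp [lam', hk]
    have hneg : ∀ k, lam' (Sum.inr k) < 0 → lam k < 0 := by
      intro k hk
      by_contra! hlk
      simp only [lam', Sum.elim_inr, min_eq_right hlk, zero_add] at hk
      split_ifs at hk <;> linarith
    by_cases hpos : 0 < lam' (Sum.inr k₀)
    · obtain ⟨cd, hcd, h₁, h₂⟩ := exists_mem_badges_le _ _ hp'' (insert (Sum.inr k₀) Q)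
        ((N.erase k₀).map Function.Embedding.inr)
        (by rintro (j | k) h
            · simp [hQ]
            · by_cases hk : k = k₀
              · simp [hk]
              · exact absurd h (hother k hk))
        (by rintro (j | k) h
            · exact absurd h (not_lt.2 (hμ j))
            · simp only [hNdef, Finset.mem_map, Finset.mem_erase, Finset.mem_filter,
                Finset.mem_univ, true_and, Function.Embedding.inr_apply, Sum.inr.injEq,
                exists_eq_right]
              exact ⟨fun hk => lt_asymm hpos (hk ▸ h), hneg k h⟩)
      have h₁' := h₁.trans (Finset.card_insert_le _ _)
      rw [Finset.card_map, Finset.card_erase_of_mem hk₀] at h₂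
      have := hmin cd hcd (by simp only; omega) (by simp only; omega)
      rw [this] at h₂
      simp only at h₂
      omega
    · obtain ⟨cd, hcd, h₁, h₂⟩ := exists_mem_badges_le _ _ hp'' Q
        (N.map Function.Embedding.inr)
        (by rintro (j | k) h
            · simp [hQ]
            · by_cases hk : k = k₀
              · exact absurd (hk ▸ h) hpos
              · exact absurd h (hother k hk))
        (by rintro (j | k) h
            · exact absurd h (not_lt.2 (hμ j))
            · simpa [hNdef] using hneg k h)
      rw [Finset.card_map] at h₂
      have := hmin cd hcd (by simp only; omega) (by simp only; omega)
      rw [this] at h₁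
      simp only at h₁
      omega

theorem swap_mem_badges_neg {s : ℕ} {p : MvPolynomial (Fin 2) ℝ} {ab : ℕ × ℕ}
    (h : ab ∈ badges s p) : ab.swap ∈ badges s (-p) := by
  obtain ⟨r, lam, α, β, ⟨hlam, hdet, hp⟩, h₁, h₂⟩ := h
  refine ⟨r, fun k => -lam k, α, β, ⟨fun k => neg_ne_zero.2 (hlam k), hdet, ?_⟩, ?_, ?_⟩
  · simp [hp]
  · simpa using h₂
  · simpa using h₁

theorem IsSignature.neg {s : ℕ} {p : MvPolynomial (Fin 2) ℝ} {a b : ℕ}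
    (h : IsSignature s p (a, b)) : IsSignature s (-p) (b, a) := by
  refine ⟨swap_mem_badges_neg h.1, fun cd hcd h₁ h₂ => ?_⟩
  have := h.2 cd.swap (neg_neg p ▸ swap_mem_badges_neg hcd) h₂ h₁
  rw [← Prod.swap_swap cd, this, Prod.swap_prod_mk]

theorem stmt10 (s : ℕ) (hs : 1 ≤ s) (p : MvPolynomial (Fin 2) ℝ)
    (hp : p ∈ MvPolynomial.homogeneousSubmodule (Fin 2) ℝ (2*s))
    (a b : ℕ) (hsig : IsSignature s p (a, b)) :
    (a = s+1 ∧ b = 0) ∨ (a = 0 ∧ b = s+1) ∨ (a ≤ s ∧ b ≤ s) := by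
  by_cases ha : a ≤ s
  · by_cases hb : b ≤ s
    · exact Or.inr (Or.inr ⟨ha, hb⟩)
    · obtain ⟨h₁, h₂⟩ := hsig.neg.eq_of_lt_fst hs (not_le.1 hb)
      exact Or.inr (Or.inl ⟨h₂, h₁⟩)
  · exact Or.inl (hsig.eq_of_lt_fst hs (not_le.1 ha))
end

section
/- If a real binary form p of degree 2s has two incomparable signatures (a,b) and (c,d) with a > c and b < d, then a + d ≥ s + 3, b + c ≥ s + 1, max{a+b, c+d} ≥ s + 2, and a, b, c, d ≥ 1. -/
open MvPolynomial

/-- The linear form `X₀ + x (X₁ - t X₀)`. -/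
noncomputable def shearedForm (t x : ℝ) : MvPolynomial (Fin 2) ℝ :=
  (1 - t * x) • X 0 + x • X 1

/-- The binary form `∑ w(x) (X₀ + x (X₁ - t X₀)) ^ (2s)` attached to a finitely supported
signed weight `w` on the line. -/
noncomputable def powerSum (s : ℕ) (t : ℝ) (w : ℝ →₀ ℝ) : MvPolynomial (Fin 2) ℝ :=
  w.sum fun x c => c • shearedForm t x ^ (2 * s)

/-- The `j`-th moment of a finitely supported weight. -/
noncomputable def moment (w : ℝ →₀ ℝ) (j : ℕ) : ℝ :=
  w.sum fun x c => c * x ^ j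

lemma shearedForm_eq (t x : ℝ) :
    shearedForm t x = C x * (X 1 - C t * X 0) + X 0 := by
  simp only [shearedForm, MvPolynomial.smul_eq_C_mul, map_sub, map_mul, map_one]
  ring

lemma powerSum_eq_sum_moment (s : ℕ) (t : ℝ) (w : ℝ →₀ ℝ) :
    powerSum s t w = ∑ j ∈ Finset.range (2 * s + 1),
      C (moment w j * (2 * s).choose j) * ((X 1 - C t * X 0) ^ j * X 0 ^ (2 * s - j)) := by
  simp only [powerSum, moment, Finsupp.sum, shearedForm_eq, add_pow, Finset.smul_sum,
    Finset.sum_mul, map_sum]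
  rw [Finset.sum_comm]
  refine Finset.sum_congr rfl fun j _ => Finset.sum_congr rfl fun x _ => ?_
  simp only [MvPolynomial.smul_eq_C_mul, map_mul, map_pow, mul_pow, map_natCast]
  ring

lemma moment_eq_of_powerSum_eq {s : ℕ} {t : ℝ} {w w' : ℝ →₀ ℝ}
    (h : powerSum s t w = powerSum s t w') {j : ℕ} (hj : j ≤ 2 * s) :
    moment w j = moment w' j := by
  have key : ∀ u : ℝ →₀ ℝ,
      (aeval ![(1 : Polynomial ℝ), Polynomial.X + Polynomial.C t] (powerSum s t u)).coeff j
        = moment u j * (2 * s).choose j := by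
    intro u
    simp only [powerSum_eq_sum_moment, map_sum, map_mul (aeval _), map_pow, map_sub, aeval_C,
      aeval_X, Matrix.cons_val_zero, Matrix.cons_val_one, Polynomial.algebraMap_eq, mul_one,
      one_pow, add_sub_cancel_right, Polynomial.finsetSum_coeff, Polynomial.coeff_C_mul_X_pow]
    rw [Finset.sum_ite_eq, if_pos (Finset.mem_range.2 (by omega))]
  have h2 := key w
  rw [h, key w'] at h2
  have hc : ((2 * s).choose j : ℝ) ≠ 0 := by
    exact_mod_cast (Nat.choose_pos hj).ne'
  exact (mul_right_cancel₀ hc h2).symm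

lemma powerSum_eq_of_moment_eq {s : ℕ} (t : ℝ) {w w' : ℝ →₀ ℝ}
    (h : ∀ j ≤ 2 * s, moment w j = moment w' j) :
    powerSum s t w = powerSum s t w' := by
  rw [powerSum_eq_sum_moment, powerSum_eq_sum_moment]
  refine Finset.sum_congr rfl fun j hj => ?_
  rw [h j (by simpa [Nat.lt_succ_iff] using hj)]

lemma powerSum_neg (s : ℕ) (t : ℝ) (w : ℝ →₀ ℝ) : powerSum s t (-w) = -powerSum s t w := by
  simp [powerSum, Finsupp.sum]

lemma ncard_setOf_eq_card_subtype {ι κ : Type*} {f : ι → κ} (hf : Function.Injective f)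
    {P : κ → Prop} {Q : ι → Prop} (hPQ : ∀ k, P (f k) ↔ Q k) (hP : ∀ x, P x → ∃ k, f k = x) :
    {x | P x}.ncard = Nat.card {k // Q k} := by
  have : {x | P x} = f '' {k | Q k} := by
    ext x
    constructor
    · intro hx
      obtain ⟨k, rfl⟩ := hP x hx
      exact ⟨k, (hPQ k).1 hx, rfl⟩
    · rintro ⟨k, hk, rfl⟩
      exact (hPQ k).2 hk
  rw [this, Set.ncard_image_of_injective _ hf, ← Nat.card_coe_set_eq]
  rfl

/-- Any finitely supported weight yields an honest representation. -/
lemma mem_badges_powerSum (s : ℕ) (t : ℝ) (w : ℝ →₀ ℝ) :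
    ({x | 0 < w x}.ncard, {x | w x < 0}.ncard) ∈ badges s (powerSum s t w) := by
  let e := w.support.equivFin.symm
  have hinj : Function.Injective fun k => (e k : ℝ) := Subtype.val_injective.comp e.injective
  have hrange : ∀ x, w x ≠ 0 → ∃ k, (e k : ℝ) = x := fun x hx =>
    ⟨e.symm ⟨x, Finsupp.mem_support_iff.2 hx⟩, by simp⟩
  refine ⟨w.support.card, fun k => w (e k), fun k => 1 - t * e k, fun k => e k, ⟨?_, ?_, ?_⟩,
    ?_, ?_⟩
  · exact fun k => Finsupp.mem_support_iff.1 (e k).2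
  · intro k l hkl h
    exact hkl (hinj (by simp only; linarith))
  · rw [powerSum, Finsupp.sum, ← Finset.sum_coe_sort, ← e.sum_comp]
    rfl
  · exact ncard_setOf_eq_card_subtype hinj (fun _ => Iff.rfl) fun x hx => hrange x (ne_of_gt hx)
  · exact ncard_setOf_eq_card_subtype hinj (fun _ => Iff.rfl) fun x hx => hrange x (ne_of_lt hx)

/-- An honest representation none of whose forms vanishes at `(1, t)` comes from a finitely
supported weight. -/
lemma IsHonestRep.exists_powerSum {s r : ℕ} {p : MvPolynomial (Fin 2) ℝ}
    {lam α β : Fin r → ℝ} (h : IsHonestRep s r p lam α β) {t : ℝ}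
    (ht : ∀ k, α k + t * β k ≠ 0) :
    ∃ w : ℝ →₀ ℝ, p = powerSum s t w ∧
      {x | 0 < w x}.ncard = Nat.card {k : Fin r // 0 < lam k} ∧
      {x | w x < 0}.ncard = Nat.card {k : Fin r // lam k < 0} := by
  obtain ⟨-, hαβ, rfl⟩ := h
  have hinj : Function.Injective fun k => β k / (α k + t * β k) := by
    intro k l hkl
    by_contra hne
    apply hαβ k l hne
    have := (div_eq_div_iff (ht k) (ht l)).1 hkl
    linarith
  let f : Fin r ↪ ℝ := ⟨_, hinj⟩
  let u : Fin r →₀ ℝ := Finsupp.equivFunOnFinite.symm fun k => lam k * (α k + t * β k) ^ (2 * s)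
  have hpos : ∀ k, 0 < (α k + t * β k) ^ (2 * s) := fun k =>
    (even_two_mul s).pow_pos (ht k)
  have hw : ∀ k, u.embDomain f (f k) = lam k * (α k + t * β k) ^ (2 * s) := fun k =>
    Finsupp.embDomain_apply_self f u k
  have hw0 : ∀ x, u.embDomain f x ≠ 0 → ∃ k, f k = x := by
    intro x hx
    by_contra hne
    exact hx (Finsupp.embDomain_of_notMem_range f u x hne)
  refine ⟨u.embDomain f, ?_, ?_, ?_⟩
  · rw [powerSum, Finsupp.sum_embDomain, Finsupp.sum_fintype _ _ (by simp)]
    refine Finset.sum_congr rfl fun k _ => ?_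
    have hform : α k • X 0 + β k • X 1 = (α k + t * β k) • shearedForm t (f k) := by
      have h1 : α k = (α k + t * β k) * (1 - t * (β k / (α k + t * β k))) := by
        field_simp [ht k]
        ring
      have h2 : β k = (α k + t * β k) * (β k / (α k + t * β k)) :=
        (mul_div_cancel₀ _ (ht k)).symm
      rw [shearedForm, smul_add, smul_smul, smul_smul]
      exact congrArg₂ _ (congrArg (· • _) h1) (congrArg (· • _) h2)
    rw [hform, smul_pow, smul_smul]
    rfl
  · exact ncard_setOf_eq_card_subtype hinj
      (fun k => (hw k).symm ▸ mul_pos_iff_of_pos_right (hpos k))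
      fun x hx => hw0 x (ne_of_gt hx)
  · exact ncard_setOf_eq_card_subtype hinj
      (fun k => (hw k).symm ▸
        ⟨fun h => neg_of_mul_neg_left h (hpos k).le, fun h => mul_neg_of_neg_of_pos h (hpos k)⟩)
      fun x hx => hw0 x (ne_of_lt hx)

lemma sum_mul_eval_eq_zero {n : ℕ} {v : ℝ →₀ ℝ} (hv : ∀ j ≤ n, moment v j = 0)
    {f : Polynomial ℝ} (hf : f.natDegree ≤ n) :
    ∑ x ∈ v.support, v x * f.eval x = 0 := by
  simp only [Polynomial.eval_eq_sum_range, Finset.mul_sum]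
  rw [Finset.sum_comm]
  refine Finset.sum_eq_zero fun j hj => ?_
  have := hv j (by rw [Finset.mem_range] at hj; omega)
  rw [moment, Finsupp.sum] at this
  rw [← mul_zero (f.coeff j), ← this, Finset.mul_sum]
  exact Finset.sum_congr rfl fun x _ => by ring

/-- A weight which is nonnegative off at most `s` points and whose moments of order at most `2s`
vanish is zero. -/
lemma eq_zero_of_moment_eq_zero {s : ℕ} {v : ℝ →₀ ℝ} (hv : ∀ j ≤ 2 * s, moment v j = 0)
    {N : Finset ℝ} (hN : N.card ≤ s) (hpos : ∀ x ∉ N, 0 ≤ v x) : v = 0 := by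
  have hoff : ∀ x ∉ N, v x = 0 := by
    let f : Polynomial ℝ := (∏ y ∈ N, (Polynomial.X - Polynomial.C y)) ^ 2
    have hdeg : f.natDegree ≤ 2 * s := by
      rw [Polynomial.natDegree_pow, Polynomial.natDegree_finsetProd_X_sub_C_eq_card]
      omega
    have hsum := sum_mul_eval_eq_zero hv hdeg
    have heval : ∀ x, f.eval x = (∏ y ∈ N, (x - y)) ^ 2 := fun x => by
      simp [f, Polynomial.eval_prod]
    have hnn : ∀ x ∈ v.support, 0 ≤ v x * f.eval x := by
      intro x _
      rw [heval]
      by_cases hx : x ∈ N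
      · rw [Finset.prod_eq_zero hx (sub_self x)]
        simp
      · exact mul_nonneg (hpos x hx) (sq_nonneg _)
    rw [Finset.sum_eq_zero_iff_of_nonneg hnn] at hsum
    intro x hx
    by_contra h0
    have h1 := hsum x (Finsupp.mem_support_iff.2 h0)
    rw [heval] at h1
    refine mul_ne_zero h0 (pow_ne_zero 2 (Finset.prod_ne_zero_iff.2 fun y hy => ?_)) h1
    exact sub_ne_zero.2 fun hxy => hx (hxy ▸ hy)
  ext x
  by_cases hx : x ∈ N
  · let g : Polynomial ℝ := ∏ y ∈ N.erase x, (Polynomial.X - Polynomial.C y)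
    have hdeg : g.natDegree ≤ 2 * s := by
      rw [Polynomial.natDegree_finsetProd_X_sub_C_eq_card]
      have := Finset.card_erase_le (s := N) (a := x)
      omega
    have hsum := sum_mul_eval_eq_zero hv hdeg
    have heval : ∀ z, g.eval z = ∏ y ∈ N.erase x, (z - y) := fun z => by
      simp [g, Polynomial.eval_prod]
    rw [Finset.sum_eq_single x] at hsum
    · refine (mul_eq_zero.1 hsum).resolve_right ?_
      rw [heval]
      exact Finset.prod_ne_zero_iff.2 fun y hy => sub_ne_zero.2 (Finset.ne_of_mem_erase hy).symm
    · intro z _ hzx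
      by_cases hz : z ∈ N
      · rw [heval, Finset.prod_eq_zero (Finset.mem_erase.2 ⟨hzx, hz⟩) (sub_self z), mul_zero]
      · rw [hoff z hz, zero_mul]
    · intro h0
      rw [Finsupp.notMem_support_iff.1 h0, zero_mul]
  · exact hoff x hx

/-- The spectral form of Gaussian quadrature: the first `2s` moments of a symmetric operator at a
vector are those of a nonnegative weight on at most `s + 1` points. -/
lemma exists_quadrature_s12 {E : Type*} [NormedAddCommGroup E] [InnerProductSpace ℝ E]
    [FiniteDimensional ℝ E] {M : E →ₗ[ℝ] E} (hM : M.IsSymmetric) (v : E) (s : ℕ) :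
    ∃ (n : ℕ) (u y : Fin n → ℝ), n ≤ s + 1 ∧ (∀ k, 0 ≤ u k) ∧
      ∀ j ≤ 2 * s, inner ℝ v ((M ^ j) v) = ∑ k, u k * y k ^ j := by
  let K : Submodule ℝ E := Submodule.span ℝ (Set.range fun j : Fin (s + 1) => (M ^ (j : ℕ)) v)
  have hK : ∀ j ≤ s, (M ^ j) v ∈ K := fun j hj =>
    Submodule.subset_span ⟨⟨j, by omega⟩, rfl⟩
  let T : K →ₗ[ℝ] K := (K.orthogonalProjectionOnto : E →ₗ[ℝ] K) ∘ₗ M ∘ₗ K.subtype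
  have hT : T.IsSymmetric := by
    intro x y
    have h1 : inner ℝ (T x) y = inner ℝ (M x) (y : E) :=
      K.inner_orthogonalProjectionOnto_eq_of_mem_right y (M x)
    have h2 : inner ℝ x (T y) = inner ℝ (x : E) (M y) :=
      K.inner_orthogonalProjectionOnto_eq_of_mem_left x (M y)
    rw [h1, h2, hM]
  let v₀ : K := ⟨v, hK 0 (Nat.zero_le s)⟩
  have hpow : ∀ j ≤ s, (((T ^ j) v₀ : K) : E) = (M ^ j) v := by
    intro j
    induction j with
    | zero => intro _; rfl
    | succ j ih =>
      intro hj
      have hmem := hK (j + 1) hj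
      rw [pow_succ', Module.End.mul_apply] at hmem ⊢
      rw [pow_succ', Module.End.mul_apply]
      change ((K.orthogonalProjectionOnto (M ((T ^ j) v₀ : K)) : K) : E) = _
      rw [ih (by omega)]
      exact K.starProjection_eq_self_iff.2 hmem
  let b := hT.eigenvectorBasis rfl
  have hTb : ∀ (j : ℕ) (k), inner ℝ ((T ^ j) v₀) (b k)
      = hT.eigenvalues rfl k ^ j * inner ℝ v₀ (b k) := by
    intro j k
    induction j with
    | zero => simp
    | succ j ih =>
      rw [pow_succ', Module.End.mul_apply, hT, hT.apply_eigenvectorBasis rfl k]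
      erw [inner_smul_right]
      change _ * inner ℝ _ (b k) = _
      rw [ih, pow_succ']
      simp [mul_assoc]
  have hMpow : ∀ (i : ℕ) (x y : E), inner ℝ ((M ^ i) x) y = inner ℝ x ((M ^ i) y) := fun i =>
    hM.pow i
  refine ⟨Module.finrank ℝ K, fun k => inner ℝ v₀ (b k) ^ 2, hT.eigenvalues rfl, ?_,
    fun k => sq_nonneg _, ?_⟩
  · simpa [K, Set.finrank] using finrank_range_le_card (R := ℝ) fun j : Fin (s + 1) => (M ^ (j : ℕ)) v
  · intro m hm
    obtain ⟨i, j, hi, hj, rfl⟩ : ∃ i j, i ≤ s ∧ j ≤ s ∧ m = i + j :=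
      ⟨m / 2, m - m / 2, by omega, by omega, by omega⟩
    rw [pow_add, Module.End.mul_apply, ← hMpow, ← hpow i hi, ← hpow j hj, ← Submodule.coe_inner,
      ← b.sum_inner_mul_inner]
    refine Finset.sum_congr rfl fun k _ => ?_
    rw [real_inner_comm ((T ^ j) v₀), hTb, hTb]
    ring

lemma exists_nonneg_moment_eq (s : ℕ) {w : ℝ →₀ ℝ} (hw : ∀ x, 0 ≤ w x) :
    ∃ w' : ℝ →₀ ℝ, (∀ x, 0 ≤ w' x) ∧ w'.support.card ≤ s + 1 ∧
      ∀ j ≤ 2 * s, moment w j = moment w' j := by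
  classical
  let M : EuclideanSpace ℝ w.support →ₗ[ℝ] EuclideanSpace ℝ w.support :=
    Matrix.toEuclideanLin (Matrix.diagonal fun i => (i : ℝ))
  have hMapp : ∀ z i, M z i = i * z i := fun z i => by
    simp [M, Matrix.toLpLin_apply, Matrix.mulVec_diagonal]
  have hM : M.IsSymmetric := by
    intro x y
    simp only [PiLp.inner_apply, hMapp]
    exact Finset.sum_congr rfl fun i _ => by simp; ring
  let v : EuclideanSpace ℝ w.support := WithLp.toLp 2 fun i => Real.sqrt (w i)
  have hMv : ∀ j i, (M ^ j) v i = (i : ℝ) ^ j * Real.sqrt (w i) := by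
    intro j i
    induction j with
    | zero => simp [v]
    | succ j ih => rw [pow_succ', Module.End.mul_apply, hMapp, ih]; ring
  obtain ⟨n, u, y, hn, hu, h⟩ := exists_quadrature_s12 hM v s
  refine ⟨∑ k, Finsupp.single (y k) (u k), ?_, ?_, ?_⟩
  · intro x
    rw [Finsupp.finsetSum_apply]
    refine Finset.sum_nonneg fun k _ => ?_
    rw [Finsupp.single_apply]
    split_ifs
    exacts [hu k, le_rfl]
  · have hsub : (∑ k, Finsupp.single (y k) (u k)).support ⊆ Finset.univ.image y := by
      refine Finsupp.support_finsetSum.trans (Finset.biUnion_subset.2 fun k _ => ?_)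
      exact Finsupp.support_single_subset.trans (by simp)
    calc _ ≤ _ := Finset.card_le_card hsub
      _ ≤ _ := Finset.card_image_le
      _ ≤ s + 1 := by simpa using hn
  · intro j hj
    have h1 : moment (∑ k, Finsupp.single (y k) (u k)) j = ∑ k, u k * y k ^ j := by
      rw [moment, ← Finsupp.sum_finsetSum_index (by simp) (by intros; ring)]
      exact Finset.sum_congr rfl fun k _ => by simp
    rw [h1, ← h j hj, moment, Finsupp.sum, ← Finset.sum_coe_sort, PiLp.inner_apply]
    refine Finset.sum_congr rfl fun i _ => ?_
    rw [hMv]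
    have := Real.mul_self_sqrt (hw i)
    simp only [v, RCLike.inner_apply, conj_trivial]
    linear_combination (-(i : ℝ) ^ j) * this

lemma ncard_setOf_pos_le_card_support (w : ℝ →₀ ℝ) :
    {x | 0 < w x}.ncard ≤ w.support.card := by
  rw [← Set.ncard_coe_finset]
  exact Set.ncard_le_ncard (fun x hx => Finsupp.mem_support_iff.2 (ne_of_gt hx))
    w.support.finite_toSet

/-- A nonnegative combination of `2s`-th powers is one of at most `s + 1` powers. -/
lemma exists_badge_le_of_nonneg (s : ℕ) (t : ℝ) {w : ℝ →₀ ℝ} (hw : ∀ x, 0 ≤ w x) :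
    ∃ m ≤ s + 1, (m, 0) ∈ badges s (powerSum s t w) ∧
      (0, m) ∈ badges s (-powerSum s t w) := by
  obtain ⟨w', hw', hcard, hmom⟩ := exists_nonneg_moment_eq s hw
  have h0 : {x | w' x < 0} = ∅ := by
    ext x
    simpa using hw' x
  refine ⟨{x | 0 < w' x}.ncard, (ncard_setOf_pos_le_card_support w').trans hcard, ?_, ?_⟩
  · rw [powerSum_eq_of_moment_eq t hmom]
    simpa [h0] using mem_badges_powerSum s t w'
  · rw [powerSum_eq_of_moment_eq t hmom, ← powerSum_neg]
    simpa [h0] using mem_badges_powerSum s t (-w')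

lemma exists_add_mul_ne_zero {ι : Type*} [Finite ι] {α β : ι → ℝ}
    (h : ∀ k, α k ≠ 0 ∨ β k ≠ 0) : ∃ t : ℝ, ∀ k, α k + t * β k ≠ 0 := by
  obtain ⟨t, ht⟩ := (Set.finite_range fun k => -α k / β k).exists_notMem
  refine ⟨t, fun k hk => ?_⟩
  by_cases hβ : β k = 0
  · rw [hβ, mul_zero, add_zero] at hk
    exact (h k).elim (fun h => h hk) (fun h => h hβ)
  · refine ht ⟨k, ?_⟩
    simp only
    rw [div_eq_iff hβ]
    linarith

lemma IsHonestRep.ne_zero_or_ne_zero {s r : ℕ} (hs : 1 ≤ s) {p : MvPolynomial (Fin 2) ℝ}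
    (hp : p ≠ 0) {lam α β : Fin r → ℝ} (h : IsHonestRep s r p lam α β) (k : Fin r) :
    α k ≠ 0 ∨ β k ≠ 0 := by
  by_contra! hk
  apply hp
  rw [h.2.2]
  refine Finset.sum_eq_zero fun l _ => ?_
  have hl : l = k := by
    by_contra hne
    exact h.2.1 l k hne (by simp [hk.1, hk.2])
  rw [hl, hk.1, hk.2, zero_smul, zero_smul, add_zero, zero_pow (by omega), smul_zero]

lemma zero_mem_badges_zero (s : ℕ) : (0, 0) ∈ badges s 0 := by
  simpa [powerSum] using mem_badges_powerSum s 0 0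

theorem stmt12 (s : ℕ) (hs : 1 ≤ s) (p : MvPolynomial (Fin 2) ℝ)
    (hp : p ∈ MvPolynomial.homogeneousSubmodule (Fin 2) ℝ (2*s))
    (a b c d : ℕ)
    (h1 : IsSignature s p (a, b)) (h2 : IsSignature s p (c, d))
    (hac : c < a) (hbd : b < d) :
    s + 3 ≤ a + d ∧ s + 1 ≤ b + c ∧ s + 2 ≤ max (a+b) (c+d) ∧
      1 ≤ a ∧ 1 ≤ b ∧ 1 ≤ c ∧ 1 ≤ d := by
  have hp0 : p ≠ 0 := by
    rintro rfl
    have := h1.2 _ (zero_mem_badges_zero s) (Nat.zero_le _) (Nat.zero_le _)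
    simp only [Prod.mk.injEq] at this
    omega
  obtain ⟨⟨r, lam, α, β, hrep, ha, hb⟩, hmin⟩ := h1
  obtain ⟨⟨r', lam', α', β', hrep', hc, hd⟩, hmin'⟩ := h2
  obtain ⟨t, ht⟩ := exists_add_mul_ne_zero (α := Sum.elim α α') (β := Sum.elim β β') (by
    rintro (k | k)
    exacts [hrep.ne_zero_or_ne_zero hs hp0 k, hrep'.ne_zero_or_ne_zero hs hp0 k])
  obtain ⟨w, hw, hwa, hwb⟩ := hrep.exists_powerSum fun k => ht (Sum.inl k)
  obtain ⟨w', hw', hwc, hwd⟩ := hrep'.exists_powerSum fun k => ht (Sum.inr k)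
  rw [← hwa] at ha
  rw [← hwb] at hb
  rw [← hwc] at hc
  rw [← hwd] at hd
  simp only at ha hb hc hd hmin hmin'
  have hbc : s + 1 ≤ b + c := by
    by_contra! hlt
    have hmom : ∀ j ≤ 2 * s, moment (w - w') j = 0 := by
      intro j hj
      have := moment_eq_of_powerSum_eq (hw.symm.trans hw') hj
      rw [moment, Finsupp.sum_sub_index (by intros; ring)]
      exact sub_eq_zero.2 this
    let N : Finset ℝ := w.support.filter (w · < 0) ∪ w'.support.filter (0 < w' ·)
    have hb' : b = (w.support.filter (w · < 0)).card := by
      rw [hb, ← Set.ncard_coe_finset]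
      congr 1
      ext x
      simpa using ne_of_lt
    have hc' : c = (w'.support.filter (0 < w' ·)).card := by
      rw [hc, ← Set.ncard_coe_finset]
      congr 1
      ext x
      simpa using ne_of_gt
    have hN : N.card ≤ s := by
      have : N.card ≤ _ + _ := Finset.card_union_le _ _
      omega
    have hzero := eq_zero_of_moment_eq_zero hmom hN fun x hx => by
      simp only [N, Finset.mem_union, Finset.mem_filter, Finsupp.mem_support_iff, not_or, not_and,
        not_lt] at hx
      have h1 : 0 ≤ w x := by
        by_cases h : w x = 0
        exacts [h.ge, hx.1 h]
      have h2 : w' x ≤ 0 := by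
        by_cases h : w' x = 0
        exacts [h.le, hx.2 h]
      rw [Finsupp.sub_apply]
      linarith
    rw [sub_eq_zero] at hzero
    rw [hzero] at ha
    omega
  have hb1 : 1 ≤ b := by
    by_contra! hb0
    have hnn : ∀ x, 0 ≤ w x := by
      have hfin : {x | w x < 0}.Finite :=
        w.support.finite_toSet.subset fun x hx => Finsupp.mem_support_iff.2 (ne_of_lt hx)
      have hempty := (Set.ncard_eq_zero hfin).1 (by omega)
      exact fun x => not_lt.1 fun hx => hempty.subset hx
    obtain ⟨m, hm, hmem, -⟩ := exists_badge_le_of_nonneg s t hnn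
    have := hmin _ (hw ▸ hmem) (by simp only; omega) (Nat.zero_le _)
    simp only [Prod.mk.injEq] at this
    omega
  have hc1 : 1 ≤ c := by
    by_contra! hc0
    have hnn : ∀ x, 0 ≤ (-w') x := by
      have hfin : {x | 0 < w' x}.Finite :=
        w'.support.finite_toSet.subset fun x hx => Finsupp.mem_support_iff.2 (ne_of_gt hx)
      have hempty := (Set.ncard_eq_zero hfin).1 (by omega)
      exact fun x => neg_nonneg.2 (not_lt.1 fun hx => hempty.subset hx)
    obtain ⟨m, hm, -, hmem⟩ := exists_badge_le_of_nonneg s t hnn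
    rw [powerSum_neg, neg_neg, ← hw'] at hmem
    have := hmin' _ hmem (Nat.zero_le _) (by simp only; omega)
    simp only [Prod.mk.injEq] at this
    omega
  omega
end
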